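/- arXiv:2203.12473 — 2 statements merged into one kernel-verified Lean document; each statement's English description precedes it below -/
import Mathlib

section
/- Let R ≥ 2 and let μ, ν be radial Borel probability measures on ℝ³ supported in the closed unit ball with μ({0}) = 0. Then the infimum I_R(μ,ν) is attained: there exists a Lipschitz-continuous minimizer f ∈ C⁰([0,R],[0,∞)) of I_R(μ,ν) which satisfies the nonlinear fixed-point equation f(a) = max_{b∈[0,R]} { Ψ_{μν}(a,b) − f(b) } for all a ∈ [0,R], and which obeys 0 ≤ f ≤ g on [2,R], where g(a) := max_{0≤b≤a} { Ψ_{μν}(a,b) − Ψ_{μν}(b,b)₊/2 }. -/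
open MeasureTheory ENNReal Set Metric Filter Real Topology
open scoped RealInnerProductSpace

noncomputable section

/-- Three-dimensional Euclidean space. -/
abbrev E3 := EuclideanSpace ℝ (Fin 3)

/-- The Coulomb kernel `|x-y|⁻¹`, valued in `ℝ≥0∞` (equal to `∞` on the diagonal). -/
def coul (x y : E3) : ℝ≥0∞ := (ENNReal.ofReal ‖x - y‖)⁻¹

/-- The Coulomb energy `D(ν₁,ν₂) = (1/2)∬ |x-y|⁻¹ dν₁ dν₂`, valued in `ℝ≥0∞`. -/
def DD (ν₁ ν₂ : Measure E3) : ℝ≥0∞ := 2⁻¹ * ∫⁻ x, ∫⁻ y, coul x y ∂ν₂ ∂ν₁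

/-- The real-valued Coulomb energy `D(ν₁,ν₂)`. -/
def Dr (ν₁ ν₂ : Measure E3) : ℝ := (DD ν₁ ν₂).toReal

/-- A measure on `ℝ³` is radial if it is invariant under all linear isometries
(rotations about the origin). -/
def IsRadial (μ : Measure E3) : Prop := ∀ e : E3 ≃ₗᵢ[ℝ] E3, Measure.map e μ = μ

/-- `μ_{v,a}` : the measure `μ` dilated by `1/a` and recentered at `v`, i.e. the pushforward
of `μ` under `u ↦ v + u/a`. -/
def dilate (μ : Measure E3) (v : E3) (a : ℝ) : Measure E3 :=
  Measure.map (fun u => v + a⁻¹ • u) μ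

/-- The first basis vector `e₁ = (1,0,0)`. -/
def e1 : E3 := EuclideanSpace.single (0 : Fin 3) (1 : ℝ)

/-- `Φ_{μν}(a,b) = a³b³(1 - 2D(μ_{0,a}, ν_{e₁,b}))`, extended by `0` when `a = 0` or `b = 0`. -/
def Phi (μ ν : Measure E3) (a b : ℝ) : ℝ :=
  if 0 < a ∧ 0 < b then a ^ 3 * b ^ 3 * (1 - 2 * Dr (dilate μ 0 a) (dilate ν e1 b)) else 0

/-- `Ψ_{μν} = Φ_{μν} + Φ_{νμ} - Φ_{νν}`. -/
def Psi (μ ν : Measure E3) (a b : ℝ) : ℝ := Phi μ ν a b + Phi ν μ a b - Phi ν ν a b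

/-- The class `𝓕_{μν}` of continuous nonnegative functions on `[0,∞)` such that
`Ψ_{μν}(a,b) ≤ f(a)+f(b)` for all `a,b ≥ 0`. -/
def FF (μ ν : Measure E3) : Set (ℝ → ℝ) :=
  {f | ContinuousOn f (Ici 0) ∧ (∀ a, 0 ≤ a → 0 ≤ f a) ∧
    ∀ a b, 0 ≤ a → 0 ≤ b → Psi μ ν a b ≤ f a + f b}

/-- `I(μ,ν) = inf_{f ∈ 𝓕_{μν}} ∫ |z|⁻⁷ f(|z|) dz`. -/
def II (μ ν : Measure E3) : ℝ≥0∞ :=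
  ⨅ f ∈ FF μ ν, ∫⁻ z : E3, ENNReal.ofReal (‖z‖ ^ (-7 : ℝ) * f ‖z‖)

/-- `g(a) = max_{0 ≤ b ≤ a} { Ψ_{μν}(a,b) - Ψ_{μν}(b,b)₊/2 }`. -/
def gPsi (μ ν : Measure E3) (a : ℝ) : ℝ :=
  sSup ((fun b => Psi μ ν a b - max (Psi μ ν b b) 0 / 2) '' Icc 0 a)

/-- The truncated class `𝓕_{μν,R}` of continuous nonnegative functions on `[0,R]` such that
`Ψ_{μν}(a,b) ≤ f(a)+f(b)` for all `0 ≤ a,b ≤ R`. -/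
def FFR (μ ν : Measure E3) (R : ℝ) : Set (ℝ → ℝ) :=
  {f | ContinuousOn f (Icc 0 R) ∧ (∀ a ∈ Icc (0:ℝ) R, 0 ≤ f a) ∧
    ∀ a b, a ∈ Icc (0:ℝ) R → b ∈ Icc (0:ℝ) R → Psi μ ν a b ≤ f a + f b}

/-- The truncated problem `I_R(μ,ν) = inf_{f ∈ 𝓕_{μν,R}} ∫_{|z|≤R} |z|⁻⁷ f(|z|) dz`. -/
def IIR (μ ν : Measure E3) (R : ℝ) : ℝ≥0∞ :=
  ⨅ f ∈ FFR μ ν R, ∫⁻ z in closedBall (0:E3) R, ENNReal.ofReal (‖z‖ ^ (-7:ℝ) * f ‖z‖)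


theorem aux_sq_polar (H : ℝ → ℝ≥0∞) (hH : Measurable H) :
    ∫⁻ p : ℝ × ℝ, H (p.1 ^ 2 + p.2 ^ 2) = ENNReal.ofReal π * ∫⁻ q in Ioi (0:ℝ), H q := by
  rw [← lintegral_comp_polarCoord_symm]
  have h1 : ∀ p : ℝ × ℝ, ENNReal.ofReal p.1 •
      H ((polarCoord.symm p).1 ^ 2 + (polarCoord.symm p).2 ^ 2)
      = ENNReal.ofReal p.1 * H (p.1 ^ 2) := by
    intro p
    have : (polarCoord.symm p).1 ^ 2 + (polarCoord.symm p).2 ^ 2 = p.1 ^ 2 := by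
      simp only [polarCoord_symm_apply]
      nlinarith [Real.sin_sq_add_cos_sq p.2]
    rw [this, smul_eq_mul]
  simp_rw [h1]
  rw [polarCoord_target, Measure.volume_eq_prod, ← Measure.prod_restrict, lintegral_prod]
  · simp only [lintegral_const, MeasurableSet.univ, Measure.restrict_apply, univ_inter,
      Real.volume_Ioo]
    rw [lintegral_mul_const _ (by fun_prop)]
    have himg : (fun r : ℝ => r ^ 2) '' Ioi 0 = Ioi 0 := by
      ext x
      constructor
      · rintro ⟨r, hr, rfl⟩
        have hr' : (0:ℝ) < r := hr
        exact pow_pos hr' 2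
      · intro hx
        exact ⟨√x, Real.sqrt_pos.2 hx, Real.sq_sqrt (le_of_lt hx)⟩
    have hsub := lintegral_image_eq_lintegral_abs_deriv_mul (s := Ioi (0:ℝ))
      (f := fun r : ℝ => r ^ 2) (f' := fun r => 2 * r) measurableSet_Ioi
      (fun x _ => by simpa using (hasDerivAt_pow 2 x).hasDerivWithinAt)
      (fun x hx y hy hxy => by
        have hx' : (0:ℝ) < x := hx
        have hy' : (0:ℝ) < y := hy
        exact (pow_left_inj₀ hx'.le hy'.le two_ne_zero).1 hxy) H
    rw [himg] at hsub
    rw [hsub]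
    have : ∫⁻ x in Ioi (0:ℝ), ENNReal.ofReal |2 * x| * H (x ^ 2)
        = ENNReal.ofReal 2 * ∫⁻ x in Ioi (0:ℝ), ENNReal.ofReal x * H (x ^ 2) := by
      rw [← lintegral_const_mul _ (by fun_prop)]
      refine setLIntegral_congr_fun measurableSet_Ioi (fun x hx => ?_)
      have hx' : (0:ℝ) < x := hx
      rw [abs_of_pos (by positivity), ENNReal.ofReal_mul (by norm_num), mul_assoc]
    rw [this, ← mul_assoc, ← ENNReal.ofReal_mul Real.pi_pos.le, mul_comm]
    congr 2
    ring
  · fun_prop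

/-- Archimedes: on the unit ball, `y₁/|y|` is uniformly distributed. -/
theorem aux_arch_ball (h : ℝ → ℝ≥0∞) (hh : Measurable h) (w : ℝ → ℝ≥0∞) (hw : Measurable w) :
    ∫⁻ y : E3, w (‖y‖ ^ 2) * h (y 0 / ‖y‖)
      = (∫⁻ p in Ioi (0:ℝ), ENNReal.ofReal π * w p * ENNReal.ofReal (√p)) *
          ∫⁻ u in Ioo (-1:ℝ) 1, h u := by
  have e1 : ∫⁻ y : E3, w (‖y‖ ^ 2) * h (y 0 / ‖y‖)
      = ∫⁻ q : ℝ × (ℝ × ℝ), w (q.1 ^ 2 + (q.2.1 ^ 2 + q.2.2 ^ 2)) *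
          h (q.1 / √(q.1 ^ 2 + (q.2.1 ^ 2 + q.2.2 ^ 2))) := by
    have hmp : MeasurePreserving (fun y : E3 => (y 0, (y 1, y 2))) volume volume := by
      have a1 := PiLp.volume_preserving_ofLp (Fin 3)
      have a2 := volume_preserving_piFinSuccAbove (fun _ : Fin 3 => ℝ) 0
      have a3 := volume_preserving_finTwoArrow ℝ
      have a4 := (MeasurePreserving.id (volume : Measure ℝ)).prod a3
      exact (a4.comp a2).comp a1
    rw [← hmp.lintegral_comp (by fun_prop)]
    refine lintegral_congr (fun y => ?_)
    have hn : ‖y‖ ^ 2 = y 0 ^ 2 + (y 1 ^ 2 + y 2 ^ 2) := by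
      rw [EuclideanSpace.norm_sq_eq, Fin.sum_univ_three]
      simp [add_assoc]
    simp only
    rw [← hn, Real.sqrt_sq (norm_nonneg _)]
  rw [e1, Measure.volume_eq_prod, lintegral_prod _ (by fun_prop)]
  have e2 : ∀ z : ℝ, ∫⁻ p : ℝ × ℝ, w (z ^ 2 + (p.1 ^ 2 + p.2 ^ 2)) *
          h (z / √(z ^ 2 + (p.1 ^ 2 + p.2 ^ 2)))
      = ENNReal.ofReal π * ∫⁻ p : ℝ, (Ioi 0).indicator 1 p * ((Ioo (-√p) (√p)).indicator 1 z *
          (w p * h (z / √p))) := by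
    intro z
    rw [aux_sq_polar (fun q => w (z ^ 2 + q) * h (z / √(z ^ 2 + q))) (by fun_prop)]
    congr 1
    rw [← lintegral_indicator measurableSet_Ioi]
    rw [← lintegral_add_left_eq_self (μ := volume) (fun p : ℝ => (Ioi (0:ℝ)).indicator 1 p *
      ((Ioo (-√p) (√p)).indicator 1 z * (w p * h (z / √p)))) (z ^ 2)]
    refine lintegral_congr (fun q => ?_)
    by_cases hq : 0 < q
    · have i1 : z ^ 2 + q ∈ Ioi (0:ℝ) := by
        have := sq_nonneg z
        simp only [mem_Ioi]; linarith
      have i2 : z ∈ Ioo (-√(z ^ 2 + q)) (√(z ^ 2 + q)) := by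
        rw [mem_Ioo, ← abs_lt]
        apply Real.lt_sqrt_of_sq_lt
        rw [sq_abs]; linarith
      simp [indicator_of_mem, i1, i2, -mem_Ioi, -mem_Ioo]
      simp [hq]
    · have i2 : z ∉ Ioo (-√(z ^ 2 + q)) (√(z ^ 2 + q)) := by
        rw [mem_Ioo, ← abs_lt]
        intro hc
        have := Real.lt_sqrt (abs_nonneg z) |>.1 hc
        rw [sq_abs] at this; linarith
      rw [indicator_of_notMem i2, indicator_of_notMem (by simpa using hq)]
      simp
  simp_rw [e2]
  have hmI : Measurable (fun x : ℝ × ℝ => (Ioo (-√x.2) (√x.2)).indicator (1 : ℝ → ℝ≥0∞) x.1) := by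
    have hs : MeasurableSet {x : ℝ × ℝ | -√x.2 < x.1 ∧ x.1 < √x.2} :=
      (measurableSet_lt (f := fun x : ℝ × ℝ => -√x.2) (g := fun x => x.1)
        (by fun_prop) (by fun_prop)).inter
        (measurableSet_lt (f := fun x : ℝ × ℝ => x.1) (g := fun x => √x.2)
        (by fun_prop) (by fun_prop))
    exact (measurable_const (a := (1:ℝ≥0∞))).indicator hs
  have hmJ : Measurable (fun x : ℝ × ℝ => (Ioi (0:ℝ)).indicator (1 : ℝ → ℝ≥0∞) x.2) :=
    ((measurable_const (a := (1:ℝ≥0∞))).indicator measurableSet_Ioi).comp measurable_snd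
  have hmeas : Measurable (Function.uncurry fun z p : ℝ => (Ioi (0:ℝ)).indicator 1 p *
      ((Ioo (-√p) (√p)).indicator 1 z * (w p * h (z / √p)))) := by
    simp only [Function.uncurry_def]
    exact hmJ.mul (hmI.mul (by fun_prop))
  rw [lintegral_const_mul _ (Measurable.lintegral_prod_right hmeas)]
  rw [lintegral_lintegral_swap hmeas.aemeasurable]
  have e3 : ∀ p : ℝ, ∫⁻ z : ℝ, (Ioi (0:ℝ)).indicator 1 p *
      ((Ioo (-√p) (√p)).indicator 1 z * (w p * h (z / √p)))
      = (Ioi (0:ℝ)).indicator (fun p => w p * ENNReal.ofReal (√p)) p * ∫⁻ u in Ioo (-1:ℝ) 1, h u := by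
    intro p
    by_cases hp : 0 < p
    · have hp' : p ∈ Ioi (0:ℝ) := hp
      have hs : 0 < √p := Real.sqrt_pos.2 hp
      simp only [indicator_of_mem hp', Pi.one_apply, one_mul]
      rw [← lintegral_indicator measurableSet_Ioo]
      have himg : Set.range (fun u : ℝ => √p * u) = univ := by
        rw [Set.range_eq_univ]
        intro x
        exact ⟨x / √p, by field_simp⟩
      have hsub := lintegral_image_eq_lintegral_abs_deriv_mul (s := univ)
        (f := fun u : ℝ => √p * u) (f' := fun _ => √p) MeasurableSet.univ
        (fun x _ => by simpa using ((hasDerivAt_id x).const_mul (√p)))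
        (fun x _ y _ hxy => by
          exact mul_left_cancel₀ hs.ne' hxy)
        (fun z => (Ioo (-√p) (√p)).indicator 1 z * (w p * h (z / √p)))
      rw [image_univ, himg] at hsub
      simp only [Measure.restrict_univ] at hsub
      rw [hsub, mul_comm (w p), ← lintegral_const_mul _ (hh.indicator measurableSet_Ioo)]
      refine lintegral_congr (fun u => ?_)
      have hdiv : √p * u / √p = u := by field_simp
      rw [abs_of_pos hs, hdiv]
      by_cases hu : u ∈ Ioo (-1:ℝ) 1
      · have hu' : √p * u ∈ Ioo (-√p) (√p) := by
          constructor <;> nlinarith [hu.1, hu.2]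
        rw [indicator_of_mem hu, indicator_of_mem hu']
        simp [mul_assoc]
      · have hu' : √p * u ∉ Ioo (-√p) (√p) := by
          intro hc
          apply hu
          constructor
          · by_contra hcc
            nlinarith [hc.1]
          · by_contra hcc
            nlinarith [hc.2]
        rw [indicator_of_notMem hu, indicator_of_notMem hu']
        simp
    · have hp' : p ∉ Ioi (0:ℝ) := hp
      simp [indicator_of_notMem hp']
  simp_rw [e3]
  rw [lintegral_mul_const _ (by
    exact Measurable.indicator (by fun_prop) measurableSet_Ioi), ← mul_assoc]
  congr 1
  rw [lintegral_indicator measurableSet_Ioi, ← lintegral_const_mul _ (by fun_prop)]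
  simp_rw [mul_assoc]

theorem aux_exists_rot (x : E3) : ∃ φ : E3 ≃ₗᵢ[ℝ] E3, φ x = ‖x‖ • e1 := by
  have hn : ‖x‖ = ‖‖x‖ • e1‖ := by
    simp [norm_smul, e1]
  exact ⟨_, Submodule.reflection_sub hn⟩

theorem aux_inner_e1 (x : E3) : ⟪e1, x⟫ = x 0 := by
  simp [e1, EuclideanSpace.inner_single_left]

theorem aux_arch_radial (μ : Measure E3) [IsProbabilityMeasure μ] (hμ : IsRadial μ)
    (k : ℝ → ℝ → ℝ≥0∞) (hk : Measurable (Function.uncurry k)) :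
    ∫⁻ x, k ‖x‖ (x 0) ∂μ
      = ∫⁻ x, (2⁻¹ * ∫⁻ u in Ioo (-1:ℝ) 1, k ‖x‖ (‖x‖ * u)) ∂μ := by
  have hk2 : ∀ {α : Type} [MeasurableSpace α] (f g : α → ℝ), Measurable f → Measurable g →
      Measurable (fun a => k (f a) (g a)) := fun f g hf hg => hk.comp (hf.prodMk hg)
  set w : ℝ → ℝ≥0∞ := (Iio (1:ℝ)).indicator 1 with hw
  have hwm : Measurable w := (measurable_const (a := (1:ℝ≥0∞))).indicator measurableSet_Iio
  have hwn : Measurable (fun y : E3 => w (‖y‖ ^ 2)) := by fun_prop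
  set C : ℝ≥0∞ := ∫⁻ p in Ioi (0:ℝ), ENNReal.ofReal π * w p * ENNReal.ofReal (√p) with hC
  have hCint : ∫⁻ y : E3, w (‖y‖ ^ 2) = C * 2 := by
    have := aux_arch_ball (fun _ => 1) measurable_const w hwm
    rw [← hC] at this
    simp only [mul_one, lintegral_const, MeasurableSet.univ, Measure.restrict_apply, univ_inter,
      Real.volume_Ioo, one_mul] at this
    rw [this]
    norm_num
  have hCvol : ∫⁻ y : E3, w (‖y‖ ^ 2) = volume (ball (0:E3) 1) := by
    rw [← lintegral_indicator_one measurableSet_ball]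
    refine lintegral_congr (fun y => ?_)
    simp only [hw, indicator, mem_Iio, mem_ball_zero_iff, Pi.one_apply]
    have : ‖y‖ ^ 2 < 1 ↔ ‖y‖ < 1 := by
      rw [sq_lt_one_iff_abs_lt_one, abs_norm]
    simp [this]
  have hC0 : C ≠ 0 := by
    intro h0
    rw [h0, zero_mul, hCvol] at hCint
    exact (measure_ball_pos volume (0:E3) one_pos).ne' hCint
  have hCt : C ≠ ∞ := by
    intro h0
    rw [h0, hCvol, ENNReal.top_mul (by norm_num)] at hCint
    exact measure_ball_lt_top.ne hCint
  have hJm : Measurable (Function.uncurry fun (y x : E3) =>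
      w (‖y‖ ^ 2) * k ‖x‖ (⟪x, y⟫ / ‖y‖)) := by
    simp only [Function.uncurry_def]
    exact Measurable.mul (hwm.comp (by fun_prop)) (hk2 _ _ (by fun_prop) (by fun_prop))
  have hJ1 : ∫⁻ y : E3, ∫⁻ x, w (‖y‖ ^ 2) * k ‖x‖ (⟪x, y⟫ / ‖y‖) ∂μ
      = C * 2 * ∫⁻ x, k ‖x‖ (x 0) ∂μ := by
    rw [← hCint, ← lintegral_mul_const _ hwn]
    have hae : ∀ᵐ y : E3, y ≠ 0 := by
      simp [ae_iff]
    refine lintegral_congr_ae ?_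
    filter_upwards [hae] with y hy
    have hy' : ‖y‖ ≠ 0 := norm_ne_zero_iff.2 hy
    rw [lintegral_const_mul _ (hk2 _ _ (by fun_prop) (by fun_prop))]
    congr 1
    obtain ⟨φ, hφ⟩ := aux_exists_rot y
    conv_rhs => rw [← hμ φ]
    rw [lintegral_map (hk2 _ _ (by fun_prop) (by fun_prop)) (by fun_prop)]
    refine lintegral_congr (fun x => ?_)
    have : ⟪x, y⟫ = ‖y‖ * (φ x) 0 := by
      rw [← φ.inner_map_map, hφ, inner_smul_right, real_inner_comm, aux_inner_e1]
    rw [this, φ.norm_map]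
    congr 1
    field_simp
  have hJ2 : ∀ x : E3, ∫⁻ y : E3, w (‖y‖ ^ 2) * k ‖x‖ (⟪x, y⟫ / ‖y‖)
      = C * ∫⁻ u in Ioo (-1:ℝ) 1, k ‖x‖ (‖x‖ * u) := by
    intro x
    rw [← aux_arch_ball (fun u => k ‖x‖ (‖x‖ * u)) (hk2 _ _ (by fun_prop) (by fun_prop)) w hwm]
    obtain ⟨φ, hφ⟩ := aux_exists_rot x
    have hm : Measurable (fun y : E3 => w (‖y‖ ^ 2) * k ‖x‖ (‖x‖ * (y 0 / ‖y‖))) :=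
      Measurable.mul hwn (hk2 _ _ (by fun_prop) (by fun_prop))
    rw [← φ.measurePreserving.lintegral_comp hm]
    refine lintegral_congr (fun y => ?_)
    have : ⟪x, y⟫ = ‖x‖ * (φ y) 0 := by
      rw [← φ.inner_map_map, hφ, inner_smul_left, aux_inner_e1]
      rfl
    rw [this, φ.norm_map, mul_div_assoc]
  rw [lintegral_lintegral_swap hJm.aemeasurable] at hJ1
  simp_rw [hJ2] at hJ1
  have hin : Measurable (fun x : E3 => ∫⁻ u in Ioo (-1:ℝ) 1, k ‖x‖ (‖x‖ * u)) := by
    apply Measurable.lintegral_prod_right (f := fun (x : E3) (u : ℝ) => k ‖x‖ (‖x‖ * u))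
    simp only [Function.uncurry_def]
    exact hk2 _ _ (by fun_prop) (by fun_prop)
  rw [lintegral_const_mul _ hin, mul_assoc] at hJ1
  have h3 := (ENNReal.mul_right_inj hC0 hCt).1 hJ1
  rw [lintegral_const_mul _ hin, h3, ← mul_assoc, ENNReal.inv_mul_cancel (by norm_num) (by norm_num),
    one_mul]

theorem aux_newton_left (ρ : ℝ) (hρ : 0 < ρ) :
    ∫⁻ u in Ioo (-1:ℝ) 1, (ENNReal.ofReal (√(ρ ^ 2 + 1 - 2 * (ρ * u))))⁻¹
      = ENNReal.ofReal ((ρ + 1 - |ρ - 1|) / ρ) := by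
  have hpos : ∀ u ∈ Ioo (-1:ℝ) 1, 0 < ρ ^ 2 + 1 - 2 * (ρ * u) := by
    intro u hu
    nlinarith [sq_nonneg (ρ - 1), mul_pos hρ (sub_pos.2 hu.2)]
  have hder : ∀ u ∈ Ioo (-1:ℝ) 1, HasDerivAt (fun u => -√(ρ ^ 2 + 1 - 2 * (ρ * u)) / ρ)
      ((√(ρ ^ 2 + 1 - 2 * (ρ * u)))⁻¹) u := by
    intro u hu
    have h0 := hpos u hu
    have h1 : HasDerivAt (fun u : ℝ => ρ ^ 2 + 1 - 2 * (ρ * u)) (-(2 * ρ)) u := by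
      have := (((hasDerivAt_id u).const_mul ρ).const_mul 2).const_sub (ρ ^ 2 + 1)
      simpa using this
    have h2 := ((h1.sqrt h0.ne').neg).div_const ρ
    have hne := (Real.sqrt_pos.2 h0).ne'
    refine h2.congr_deriv ?_
    generalize √(ρ ^ 2 + 1 - 2 * (ρ * u)) = s at hne
    field_simp
  have hcont : ContinuousOn (fun u => -√(ρ ^ 2 + 1 - 2 * (ρ * u)) / ρ) (Icc (-1:ℝ) 1) := by
    fun_prop
  have hnn : ∀ u ∈ Ioo (-1:ℝ) 1, 0 ≤ (√(ρ ^ 2 + 1 - 2 * (ρ * u)))⁻¹ := fun u _ => by positivity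
  have hint := intervalIntegral.integrableOn_deriv_of_nonneg hcont hder hnn
  have hI := intervalIntegral.integral_eq_sub_of_hasDerivAt_of_le (by norm_num) hcont hder
    ((intervalIntegrable_iff_integrableOn_Ioc_of_le (by norm_num)).2 hint)
  rw [intervalIntegral.integral_of_le (by norm_num), integral_Ioc_eq_integral_Ioo] at hI
  have h3 : ∫⁻ u in Ioo (-1:ℝ) 1, (ENNReal.ofReal (√(ρ ^ 2 + 1 - 2 * (ρ * u))))⁻¹
      = ∫⁻ u in Ioo (-1:ℝ) 1, ENNReal.ofReal ((√(ρ ^ 2 + 1 - 2 * (ρ * u)))⁻¹) := by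
    refine setLIntegral_congr_fun measurableSet_Ioo (fun u hu => ?_)
    rw [ENNReal.ofReal_inv_of_pos (Real.sqrt_pos.2 (hpos u hu))]
  rw [h3, ← ofReal_integral_eq_lintegral_ofReal
    (hint.mono_set Ioo_subset_Ioc_self) (ae_of_all _ fun u => by positivity), hI]
  congr 1
  have s1 : √(ρ ^ 2 + 1 - 2 * (ρ * 1)) = |ρ - 1| := by
    rw [← Real.sqrt_sq_eq_abs]; congr 1; ring
  have s2 : √(ρ ^ 2 + 1 - 2 * (ρ * -1)) = ρ + 1 := by
    rw [← Real.sqrt_sq (by positivity : 0 ≤ ρ + 1)]; congr 1; ring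
  rw [s1, s2]
  ring

theorem aux_newton (ρ : ℝ) (hρ : 0 ≤ ρ) :
    ∫⁻ u in Ioo (-1:ℝ) 1, (ENNReal.ofReal (√(ρ ^ 2 + 1 - 2 * (ρ * u))))⁻¹
      = ∫⁻ u in Ioo (-1:ℝ) 1, {t : ℝ | |t| ≤ 1}.indicator 1 (ρ * u) := by
  rcases hρ.eq_or_lt with rfl | hρ
  · simp
  rw [aux_newton_left ρ hρ]
  have hset : MeasurableSet {u : ℝ | |ρ * u| ≤ 1} :=
    measurableSet_le (by fun_prop) (by fun_prop)
  have h1 : ∫⁻ u in Ioo (-1:ℝ) 1, {t : ℝ | |t| ≤ 1}.indicator (1 : ℝ → ℝ≥0∞) (ρ * u)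
      = volume ({u : ℝ | |ρ * u| ≤ 1} ∩ Ioo (-1:ℝ) 1) := by
    rw [← Measure.restrict_apply hset, ← lintegral_indicator_one hset]
    rfl
  rw [h1]
  rcases le_total ρ 1 with h | h
  · have : {u : ℝ | |ρ * u| ≤ 1} ∩ Ioo (-1:ℝ) 1 = Ioo (-1:ℝ) 1 := by
      apply inter_eq_right.2
      intro u hu
      simp only [mem_ofPred_eq]
      rw [abs_mul, abs_of_pos hρ]
      have : |u| < 1 := abs_lt.2 hu
      nlinarith [abs_nonneg u]
    rw [this, Real.volume_Ioo, abs_of_nonpos (by linarith)]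
    congr 1
    field_simp
    ring
  · have h2 : {u : ℝ | |ρ * u| ≤ 1} = Icc (-ρ⁻¹) ρ⁻¹ := by
      ext u
      simp only [mem_ofPred_eq, mem_Icc]
      rw [← abs_le, abs_mul, abs_of_pos hρ, mul_comm ρ |u|,
        ← le_div_iff₀ hρ, one_div]
    have h3 : volume ({u : ℝ | |ρ * u| ≤ 1} ∩ Ioo (-1:ℝ) 1) = volume (Icc (-ρ⁻¹) ρ⁻¹ ∩ Icc (-1:ℝ) 1) := by
      rw [h2]
      exact measure_congr ((ae_eq_refl _).inter Ioo_ae_eq_Icc)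
    have h4 : ρ⁻¹ ≤ 1 := inv_le_one_of_one_le₀ h
    rw [h3, inter_eq_left.2 (Icc_subset_Icc (by linarith) h4), Real.volume_Icc,
      abs_of_nonneg (by linarith)]
    congr 1
    field_simp
    ring

theorem aux_coul_radial (ζ : Measure E3) [IsProbabilityMeasure ζ] (hζ : IsRadial ζ) :
    ∫⁻ z, (ENNReal.ofReal ‖z - e1‖)⁻¹ ∂ζ = ζ {z | |z 0| ≤ 1} := by
  have hS : MeasurableSet {t : ℝ | |t| ≤ 1} := measurableSet_le (by fun_prop) (by fun_prop)
  have h1 : ∀ z : E3, (ENNReal.ofReal ‖z - e1‖)⁻¹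
      = (fun r t : ℝ => (ENNReal.ofReal (√(r ^ 2 + 1 - 2 * t)))⁻¹) ‖z‖ (z 0) := by
    intro z
    simp only
    congr 2
    rw [← Real.sqrt_sq (norm_nonneg (z - e1)), norm_sub_sq_real, real_inner_comm, aux_inner_e1]
    congr 1
    simp [e1]
    ring
  simp_rw [h1]
  rw [aux_arch_radial ζ hζ (fun r t : ℝ => (ENNReal.ofReal (√(r ^ 2 + 1 - 2 * t)))⁻¹)
    (by simp only [Function.uncurry_def]; fun_prop)]
  simp_rw [fun z : E3 => aux_newton ‖z‖ (norm_nonneg z)]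
  have hm : Measurable ({t : ℝ | |t| ≤ 1}.indicator (1 : ℝ → ℝ≥0∞)) :=
    (measurable_const (a := (1:ℝ≥0∞))).indicator hS
  rw [← aux_arch_radial ζ hζ (fun r t : ℝ => {t : ℝ | |t| ≤ 1}.indicator 1 t)
    (by simp only [Function.uncurry_def]; exact hm.comp measurable_snd)]
  rw [← lintegral_indicator_one (measurableSet_le (by fun_prop) (by fun_prop))]
  rfl

theorem aux_DD (μ ν : Measure E3) [IsProbabilityMeasure μ] [IsProbabilityMeasure ν]
    (hμ : IsRadial μ) (hν : IsRadial ν) (a b : ℝ) :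
    ∫⁻ x, ∫⁻ y, coul x y ∂(dilate ν e1 b) ∂(dilate μ 0 a)
      = (μ.prod ν) {p | |a⁻¹ * p.1 0 - b⁻¹ * p.2 0| ≤ 1} := by
  set T : E3 × E3 → E3 := fun p => a⁻¹ • p.1 - b⁻¹ • p.2 with hT
  have hTm : Measurable T := by fun_prop
  have : IsProbabilityMeasure (Measure.map T (μ.prod ν)) :=
    Measure.isProbabilityMeasure_map hTm.aemeasurable
  have hrad : IsRadial (Measure.map T (μ.prod ν)) := by
    intro φ
    have hc : Measurable (Prod.map φ φ) := by fun_prop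
    rw [Measure.map_map (by fun_prop) hTm]
    have h1 : φ ∘ T = T ∘ Prod.map φ φ := by
      ext p
      simp [hT]
    rw [h1, ← Measure.map_map hTm hc, ← Measure.map_prod_map _ _ (by fun_prop) (by fun_prop),
      hμ φ, hν φ]
  have h2 := aux_coul_radial _ hrad
  rw [lintegral_map (by fun_prop) hTm, Measure.map_apply hTm
    (measurableSet_le (by fun_prop) (by fun_prop)), lintegral_prod _ (by fun_prop)] at h2
  have hcm : Measurable (Function.uncurry coul) := by
    simp only [Function.uncurry_def, coul]
    fun_prop
  unfold dilate
  rw [lintegral_map (Measurable.lintegral_prod_right hcm) (by fun_prop)]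
  refine Eq.trans ?_ (h2.trans ?_)
  · refine lintegral_congr fun x => ?_
    rw [lintegral_map (by unfold coul; fun_prop) (by fun_prop)]
    refine lintegral_congr fun y => ?_
    simp only [coul, hT]
    congr 3
    module
  · congr 1

theorem aux_Phi (μ ν : Measure E3) [IsProbabilityMeasure μ] [IsProbabilityMeasure ν]
    (hμ : IsRadial μ) (hν : IsRadial ν) (a b : ℝ) (ha : 0 < a) (hb : 0 < b) :
    Phi μ ν a b = a ^ 3 * b ^ 3 * (μ.prod ν).real {p | 1 < |a⁻¹ * p.1 0 - b⁻¹ * p.2 0|} := by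
  rw [Phi, if_pos ⟨ha, hb⟩, Dr, DD, aux_DD μ ν hμ hν a b]
  congr 1
  rw [ENNReal.toReal_mul]
  have hs : MeasurableSet {p : E3 × E3 | |a⁻¹ * p.1 0 - b⁻¹ * p.2 0| ≤ 1} :=
    measurableSet_le (by fun_prop) (by fun_prop)
  have h2 : {p : E3 × E3 | 1 < |a⁻¹ * p.1 0 - b⁻¹ * p.2 0|}
      = {p : E3 × E3 | |a⁻¹ * p.1 0 - b⁻¹ * p.2 0| ≤ 1}ᶜ := by
    ext p; simp
  rw [h2, probReal_compl_eq_one_sub hs]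
  simp [Measure.real]

theorem aux_slab (μ : Measure E3) [IsProbabilityMeasure μ] (hμ : IsRadial μ)
    (a a' d : ℝ) (ha : 0 < a) (haa : a ≤ a') :
    μ {x | ¬(a * d < x 0 ↔ a' * d < x 0) ∨ ¬(x 0 < a * d ↔ x 0 < a' * d)}
      ≤ ENNReal.ofReal ((a' - a) / a) := by
  set S : Set ℝ := {t | ¬(a * d < t ↔ a' * d < t) ∨ ¬(t < a * d ↔ t < a' * d)} with hS
  have hSm : MeasurableSet S := by
    have m1 : MeasurableSet {t : ℝ | a * d < t} := measurableSet_Ioi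
    have m2 : MeasurableSet {t : ℝ | a' * d < t} := measurableSet_Ioi
    have m3 : MeasurableSet {t : ℝ | t < a * d} := measurableSet_Iio
    have m4 : MeasurableSet {t : ℝ | t < a' * d} := measurableSet_Iio
    have : S = (({t : ℝ | a * d < t} \ {t : ℝ | a' * d < t}) ∪
        ({t : ℝ | a' * d < t} \ {t : ℝ | a * d < t})) ∪
        (({t : ℝ | t < a * d} \ {t : ℝ | t < a' * d}) ∪
        ({t : ℝ | t < a' * d} \ {t : ℝ | t < a * d})) := by
      ext t
      simp only [hS, mem_ofPred_eq, mem_union, Set.mem_sdiff]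
      tauto
    rw [this]
    exact ((m1.diff m2).union (m2.diff m1)).union ((m3.diff m4).union (m4.diff m3))
  have hm : Measurable (S.indicator (1 : ℝ → ℝ≥0∞)) :=
    (measurable_const (a := (1:ℝ≥0∞))).indicator hSm
  have hx0 : Measurable (fun x : E3 => x 0) := by fun_prop
  have h1 : μ {x | x 0 ∈ S} = ∫⁻ x, S.indicator 1 (x 0) ∂μ := by
    have := lintegral_indicator_one (μ := μ) (hx0 hSm)
    exact this.symm
  change μ {x | x 0 ∈ S} ≤ _
  rw [h1, aux_arch_radial μ hμ (fun r t : ℝ => S.indicator 1 t)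
    (by simp only [Function.uncurry_def]; exact hm.comp measurable_snd)]
  have hb : ∀ x : E3, 2⁻¹ * ∫⁻ u in Ioo (-1:ℝ) 1, S.indicator (1 : ℝ → ℝ≥0∞) (‖x‖ * u)
      ≤ ENNReal.ofReal ((a' - a) / a) := by
    intro x
    have hr0 : 0 ≤ ‖x‖ := norm_nonneg x
    generalize ‖x‖ = r at hr0
    have hset : MeasurableSet {u : ℝ | r * u ∈ S} := (measurable_const_mul r) hSm
    have h2 : ∫⁻ u in Ioo (-1:ℝ) 1, S.indicator (1 : ℝ → ℝ≥0∞) (r * u)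
        = volume ({u : ℝ | r * u ∈ S} ∩ Ioo (-1:ℝ) 1) := by
      rw [← Measure.restrict_apply hset, ← lintegral_indicator_one hset]
      rfl
    rw [h2]
    refine le_trans (mul_le_of_le_one_left (zero_le) (by
      rw [ENNReal.inv_le_one]; norm_num)) ?_
    by_cases hc : r ≤ a * |d|
    · have : {u : ℝ | r * u ∈ S} ∩ Ioo (-1:ℝ) 1 = ∅ := by
        ext u
        simp only [mem_inter_iff, mem_ofPred_eq, mem_empty_iff_false, iff_false, not_and, hS]
        intro hu hu1
        have hu2 : |u| < 1 := abs_lt.2 hu1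
        apply hu.elim
        all_goals
        · intro hn
          apply hn
          have ha' : 0 < a' := ha.trans_le haa
          rcases hr0.eq_or_lt with rfl | hr
          · rcases lt_trichotomy d 0 with hd | rfl | hd
            · have := mul_neg_of_pos_of_neg ha hd
              have := mul_neg_of_pos_of_neg ha' hd
              constructor <;> intro <;> linarith
            · simp
            · have := mul_pos ha hd
              have := mul_pos ha' hd
              constructor <;> intro <;> linarith
          · have h5 : |r * u| < r := by
              rw [abs_mul, abs_of_pos hr]; nlinarith
            rw [abs_lt] at h5
            have h6 : a * |d| ≤ a' * |d| := by gcongr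
            rcases abs_cases d with ⟨h7, h8⟩ | ⟨h7, h8⟩
            · rw [h7] at hc h6
              constructor <;> intro <;> linarith [h5.1, h5.2]
            · rw [h7] at hc h6
              constructor <;> intro <;> linarith [h5.1, h5.2]
      rw [this]; simp
    · push Not at hc
      have hr : 0 < r := lt_of_le_of_lt (by positivity) hc
      have hsub : {u : ℝ | r * u ∈ S} ∩ Ioo (-1:ℝ) 1 ⊆ uIcc (a * d / r) (a' * d / r) := by
        rintro u ⟨hu, -⟩
        simp only [mem_ofPred_eq, hS] at hu
        rw [mem_uIcc]
        rw [div_le_iff₀ hr, le_div_iff₀ hr, div_le_iff₀ hr, le_div_iff₀ hr, mul_comm u r]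
        by_contra hcon
        push Not at hcon
        rcases le_total (a * d) (a' * d) with h | h
        · rcases hu with hu | hu
          · apply hu
            constructor
            · intro h9
              exact hcon.1 h9.le
            · intro h9; linarith
          · apply hu
            constructor
            · intro h9; linarith
            · intro h9
              by_contra hh
              push Not at hh
              linarith [hcon.1 hh]
        · rcases hu with hu | hu
          · apply hu
            constructor
            · intro h9; linarith
            · intro h9
              exact hcon.2 h9.le
          · apply hu
            constructor
            · intro h9
              by_contra hh
              push Not at hh
              linarith [hcon.2 hh]
            · intro h9; linarith
      refine (measure_mono hsub).trans ?_
      rw [Real.volume_interval]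
      apply ENNReal.ofReal_le_ofReal
      have : a' * d / r - a * d / r = (a' - a) * (d / r) := by ring
      rw [this, abs_mul, abs_of_nonneg (by linarith), abs_div, abs_of_pos hr, div_eq_mul_inv _ a]
      apply mul_le_mul_of_nonneg_left _ (by linarith)
      rw [div_le_iff₀ hr, ← div_eq_inv_mul, le_div_iff₀ ha]
      linarith
  calc _ ≤ ∫⁻ x, ENNReal.ofReal ((a' - a) / a) ∂μ := lintegral_mono hb
    _ = _ := by simp

theorem aux_prob_diff (μ ν : Measure E3) [IsProbabilityMeasure μ] [IsProbabilityMeasure ν]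
    (hμ : IsRadial μ) (a a' b : ℝ) (ha : 0 < a) (haa : a ≤ a') :
    |(μ.prod ν).real {p | 1 < |a⁻¹ * p.1 0 - b⁻¹ * p.2 0|}
      - (μ.prod ν).real {p | 1 < |a'⁻¹ * p.1 0 - b⁻¹ * p.2 0|}| ≤ 2 * ((a' - a) / a) := by
  have ha' : 0 < a' := ha.trans_le haa
  have hm : ∀ c : ℝ, MeasurableSet {p : E3 × E3 | 1 < |c⁻¹ * p.1 0 - b⁻¹ * p.2 0|} := fun c =>
    measurableSet_lt (by fun_prop) (by fun_prop)
  refine (abs_measureReal_sub_le_measureReal_symmDiff (hm a).nullMeasurableSet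
    (hm a').nullMeasurableSet).trans ?_
  have hnn : 0 ≤ (a' - a) / a := div_nonneg (by linarith) ha.le
  rw [Measure.real]
  apply ENNReal.toReal_le_of_le_ofReal (by positivity)
  rw [Measure.prod_apply_symm ((hm a).symmDiff (hm a'))]
  calc _ ≤ ∫⁻ y, ENNReal.ofReal (2 * ((a' - a) / a)) ∂ν := by
        refine lintegral_mono fun y => ?_
        set c := b⁻¹ * y 0 with hc
        have h1 := aux_slab μ hμ a a' (c + 1) ha haa
        have h2 := aux_slab μ hμ a a' (c - 1) ha haa
        rw [two_mul, ENNReal.ofReal_add hnn hnn]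
        refine le_trans (le_trans (measure_mono ?_) (measure_union_le _ _)) (add_le_add h1 h2)
        intro x hx
        have key : ∀ e : ℝ, 0 < e → (1 < |e⁻¹ * x 0 - c| ↔
            (e * (c + 1) < x 0 ∨ x 0 < e * (c - 1))) := by
          intro e he
          rw [lt_abs]
          have e1 : 1 < e⁻¹ * x 0 - c ↔ e * (c + 1) < x 0 := by
            rw [lt_sub_iff_add_lt, ← div_eq_inv_mul, lt_div_iff₀ he, mul_comm, add_comm]
          have e2 : 1 < -(e⁻¹ * x 0 - c) ↔ x 0 < e * (c - 1) := by
            rw [neg_sub, lt_sub_comm, ← div_eq_inv_mul, div_lt_iff₀ he, mul_comm]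
          rw [e1, e2]
        have hx' : ((1 < |a⁻¹ * x 0 - c|) ∧ ¬ (1 < |a'⁻¹ * x 0 - c|)) ∨
            ((1 < |a'⁻¹ * x 0 - c|) ∧ ¬ (1 < |a⁻¹ * x 0 - c|)) := hx
        rw [key a ha, key a' ha'] at hx'
        simp only [mem_union, mem_ofPred_eq]
        tauto
    _ = _ := by simp

theorem aux_Phi_zero_left (μ ν : Measure E3) (b : ℝ) : Phi μ ν 0 b = 0 := by simp [Phi]
theorem aux_Phi_zero_right (μ ν : Measure E3) (b : ℝ) : Phi μ ν b 0 = 0 := by simp [Phi]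

theorem aux_Phi_bounds (μ ν : Measure E3) [IsProbabilityMeasure μ] [IsProbabilityMeasure ν]
    (hμ : IsRadial μ) (hν : IsRadial ν)
    (a b : ℝ) (ha : 0 ≤ a) (hb : 0 ≤ b) :
    0 ≤ Phi μ ν a b ∧ Phi μ ν a b ≤ a ^ 3 * b ^ 3 := by
  rcases ha.eq_or_lt with rfl | ha
  · simp [aux_Phi_zero_left]
  rcases hb.eq_or_lt with rfl | hb
  · simp [aux_Phi_zero_right]
  rw [aux_Phi μ ν hμ hν a b ha hb]
  refine ⟨by positivity, ?_⟩
  exact mul_le_of_le_one_right (by positivity) measureReal_le_one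

theorem aux_Phi_symm (μ ν : Measure E3) [IsProbabilityMeasure μ] [IsProbabilityMeasure ν]
    (hμ : IsRadial μ) (hν : IsRadial ν)
    (a b : ℝ) : Phi μ ν a b = Phi ν μ b a := by
  by_cases h : 0 < a ∧ 0 < b
  · rw [aux_Phi μ ν hμ hν a b h.1 h.2, aux_Phi ν μ hν hμ b a h.2 h.1, mul_comm (a ^ 3)]
    congr 1
    rw [← Measure.prod_swap (μ := μ) (ν := ν), Measure.real, Measure.real,
      Measure.map_apply measurable_swap (measurableSet_lt (by fun_prop) (by fun_prop))]
    congr 2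
    ext p
    simp only [mem_preimage, mem_ofPred_eq, Prod.fst_swap, Prod.snd_swap]
    rw [abs_sub_comm]
  · rw [Phi, Phi, if_neg h, if_neg (fun h' => h ⟨h'.2, h'.1⟩)]

theorem aux_Phi_lip_le (μ ν : Measure E3) [IsProbabilityMeasure μ] [IsProbabilityMeasure ν]
    (hμ : IsRadial μ) (hν : IsRadial ν)
    (R : ℝ) (a a' b : ℝ) (ha : 0 ≤ a) (haa : a ≤ a') (haR : a' ≤ R)
    (hb : 0 ≤ b) (hbR : b ≤ R) :
    |Phi μ ν a b - Phi μ ν a' b| ≤ 5 * R ^ 5 * (a' - a) := by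
  have hR : 0 ≤ R := hb.trans hbR
  rcases hb.eq_or_lt with rfl | hb
  · rw [aux_Phi_zero_right, aux_Phi_zero_right, sub_zero, abs_zero]
    exact mul_nonneg (by positivity) (by linarith)
  have hb3 : b ^ 3 ≤ R ^ 3 := by gcongr
  rcases ha.eq_or_lt with rfl | ha
  · obtain ⟨h1, h2⟩ := aux_Phi_bounds μ ν hμ hν a' b haa hb.le
    rw [aux_Phi_zero_left, zero_sub, abs_neg, abs_of_nonneg h1, sub_zero]
    calc Phi μ ν a' b ≤ a' ^ 3 * b ^ 3 := h2
      _ = (a' ^ 2 * b ^ 3) * a' := by ring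
      _ ≤ (R ^ 2 * R ^ 3) * a' := by gcongr
      _ ≤ 5 * R ^ 5 * a' := by
        have : 0 ≤ R ^ 5 * a' := by positivity
        nlinarith
  have ha' : 0 < a' := ha.trans_le haa
  rw [aux_Phi μ ν hμ hν a b ha hb, aux_Phi μ ν hμ hν a' b ha' hb]
  have hd := aux_prob_diff μ ν hμ a a' b ha haa
  have hp1 : (μ.prod ν).real {p | 1 < |a'⁻¹ * p.1 0 - b⁻¹ * p.2 0|} ≤ 1 := measureReal_le_one
  have hp0 : 0 ≤ (μ.prod ν).real {p | 1 < |a'⁻¹ * p.1 0 - b⁻¹ * p.2 0|} := measureReal_nonneg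
  generalize (μ.prod ν).real {p | 1 < |a'⁻¹ * p.1 0 - b⁻¹ * p.2 0|} = p' at *
  generalize (μ.prod ν).real {p | 1 < |a⁻¹ * p.1 0 - b⁻¹ * p.2 0|} = p at *
  have e : a ^ 3 * b ^ 3 * p - a' ^ 3 * b ^ 3 * p'
      = b ^ 3 * (a ^ 3 * (p - p') - (a' ^ 3 - a ^ 3) * p') := by ring
  have haR' : a ≤ R := haa.trans haR
  have hle : a ^ 3 ≤ a' ^ 3 := by gcongr
  have k1 : |a ^ 3 * (p - p')| ≤ 2 * R ^ 2 * (a' - a) := by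
    rw [abs_mul, abs_of_pos (by positivity)]
    calc a ^ 3 * |p - p'| ≤ a ^ 3 * (2 * ((a' - a) / a)) := by gcongr
      _ = 2 * a ^ 2 * (a' - a) := by field_simp
      _ ≤ 2 * R ^ 2 * (a' - a) := by
        apply mul_le_mul_of_nonneg_right _ (by linarith)
        gcongr
  have k2 : |(a' ^ 3 - a ^ 3) * p'| ≤ 3 * R ^ 2 * (a' - a) := by
    rw [abs_mul, abs_of_nonneg (by linarith), abs_of_nonneg hp0]
    calc (a' ^ 3 - a ^ 3) * p' ≤ (a' ^ 3 - a ^ 3) * 1 := by gcongr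
      _ = (a' ^ 2 + a' * a + a ^ 2) * (a' - a) := by ring
      _ ≤ (R ^ 2 + R * R + R ^ 2) * (a' - a) := by
        apply mul_le_mul_of_nonneg_right _ (by linarith)
        gcongr
      _ = 3 * R ^ 2 * (a' - a) := by ring
  rw [e, abs_mul, abs_of_pos (by positivity)]
  calc b ^ 3 * |a ^ 3 * (p - p') - (a' ^ 3 - a ^ 3) * p'|
      ≤ R ^ 3 * (2 * R ^ 2 * (a' - a) + 3 * R ^ 2 * (a' - a)) := by
        apply mul_le_mul hb3 ((abs_sub _ _).trans (add_le_add k1 k2)) (abs_nonneg _) (by positivity)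
    _ = _ := by ring

theorem aux_Phi_lip (μ ν : Measure E3) [IsProbabilityMeasure μ] [IsProbabilityMeasure ν]
    (hμ : IsRadial μ) (hν : IsRadial ν)
    (R : ℝ) (a a' b : ℝ) (ha : a ∈ Icc 0 R) (ha' : a' ∈ Icc 0 R)
    (hb : b ∈ Icc 0 R) :
    |Phi μ ν a b - Phi μ ν a' b| ≤ 5 * R ^ 5 * |a - a'| := by
  rcases le_total a a' with h | h
  · rw [abs_sub_comm a a', abs_of_nonneg (by linarith : 0 ≤ a' - a)]
    exact aux_Phi_lip_le μ ν hμ hν R a a' b ha.1 h ha'.2 hb.1 hb.2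
  · rw [abs_sub_comm, abs_of_nonneg (by linarith : 0 ≤ a - a')]
    exact aux_Phi_lip_le μ ν hμ hν R a' a b ha'.1 h ha.2 hb.1 hb.2

theorem aux_Phi_far (μ ν : Measure E3) [IsProbabilityMeasure μ] [IsProbabilityMeasure ν]
    (hμ : IsRadial μ) (hν : IsRadial ν)
    (hμs : μ (closedBall (0:E3) 1)ᶜ = 0) (hνs : ν (closedBall (0:E3) 1)ᶜ = 0)
    (a b : ℝ) (ha : 2 ≤ a) (hb : 2 ≤ b) : Phi μ ν a b = 0 := by
  rw [aux_Phi μ ν hμ hν a b (by linarith) (by linarith)]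
  have h0 : (μ.prod ν) {p | 1 < |a⁻¹ * p.1 0 - b⁻¹ * p.2 0|} = 0 := by
    have h1 : ∀ᵐ p ∂(μ.prod ν), p.1 ∈ closedBall (0:E3) 1 :=
      Measure.quasiMeasurePreserving_fst.ae (show ∀ᵐ x ∂μ, x ∈ closedBall (0:E3) 1 from hμs)
    have h2 : ∀ᵐ p ∂(μ.prod ν), p.2 ∈ closedBall (0:E3) 1 :=
      Measure.quasiMeasurePreserving_snd.ae (show ∀ᵐ x ∂ν, x ∈ closedBall (0:E3) 1 from hνs)
    have h3 : ∀ᵐ p ∂(μ.prod ν), ¬ (1 < |a⁻¹ * p.1 0 - b⁻¹ * p.2 0|) := by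
      filter_upwards [h1, h2] with p hp1 hp2
      have key : ∀ (c : ℝ) (x : E3), 2 ≤ c → x ∈ closedBall (0:E3) 1 → |c⁻¹ * x 0| ≤ 1 / 2 := by
        intro c x hc hx
        have hx1 : ‖x‖ ≤ 1 := by simpa using hx
        have hx2 : |x 0| ≤ 1 := by
          have := PiLp.norm_apply_le x 0
          rw [Real.norm_eq_abs] at this
          linarith
        rw [abs_mul, abs_of_pos (by positivity), ← div_eq_inv_mul, div_le_iff₀ (by linarith)]
        linarith
      have := abs_sub (a⁻¹ * p.1 0) (b⁻¹ * p.2 0)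
      linarith [key a p.1 ha hp1, key b p.2 hb hp2]
    simpa [ae_iff] using h3
  rw [Measure.real, h0]
  simp


/-- The conjugate `a ↦ sup_b (P(a,b) - f(b))`. -/
def auxConj (P : ℝ → ℝ → ℝ) (R : ℝ) (f : ℝ → ℝ) (a : ℝ) : ℝ :=
  sSup ((fun b => P a b - f b) '' Icc 0 R)

/-- Admissible functions vanishing at the origin, without any regularity. -/
structure AuxGood (P : ℝ → ℝ → ℝ) (R : ℝ) (f : ℝ → ℝ) : Prop where
  nonneg : ∀ a ∈ Icc (0:ℝ) R, 0 ≤ f a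
  adm : ∀ a b, a ∈ Icc (0:ℝ) R → b ∈ Icc (0:ℝ) R → P a b ≤ f a + f b
  zero : f 0 = 0

/-- The properties of the kernel used in the optimization argument. -/
structure AuxKernel (P : ℝ → ℝ → ℝ) (R K : ℝ) : Prop where
  hR : 0 ≤ R
  hK : 0 ≤ K
  symm : ∀ a b, P a b = P b a
  zero : ∀ a, P a 0 = 0
  lip : ∀ a a' b, a ∈ Icc 0 R → a' ∈ Icc 0 R → b ∈ Icc 0 R → |P a b - P a' b| ≤ K * |a - a'|

theorem AuxKernel.bdd {P : ℝ → ℝ → ℝ} {R K : ℝ} (hP : AuxKernel P R K) {a b : ℝ}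
    (ha : a ∈ Icc 0 R) (hb : b ∈ Icc 0 R) : P a b ≤ K * R := by
  have h := hP.lip a 0 b ha ⟨le_rfl, hP.hR⟩ hb
  rw [hP.symm 0 b, hP.zero, sub_zero, sub_zero, abs_of_nonneg ha.1] at h
  have := (abs_le.1 h).2
  have := mul_le_mul_of_nonneg_left ha.2 hP.hK
  linarith

theorem AuxKernel.bddAbove {P : ℝ → ℝ → ℝ} {R K : ℝ} (hP : AuxKernel P R K) {f : ℝ → ℝ}
    (hf : ∀ a ∈ Icc (0:ℝ) R, 0 ≤ f a) {a : ℝ} (ha : a ∈ Icc 0 R) :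
    BddAbove ((fun b => P a b - f b) '' Icc 0 R) := by
  refine ⟨K * R, ?_⟩
  rintro _ ⟨b, hb, rfl⟩
  have := hP.bdd ha hb
  have := hf b hb
  simp only
  linarith

theorem AuxKernel.le_conj {P : ℝ → ℝ → ℝ} {R K : ℝ} (hP : AuxKernel P R K) {f : ℝ → ℝ}
    (hf : ∀ a ∈ Icc (0:ℝ) R, 0 ≤ f a) {a b : ℝ} (ha : a ∈ Icc 0 R) (hb : b ∈ Icc 0 R) :
    P a b - f b ≤ auxConj P R f a :=
  le_csSup (hP.bddAbove hf ha) ⟨b, hb, rfl⟩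

theorem AuxKernel.conj_le {P : ℝ → ℝ → ℝ} {R K : ℝ} (hP : AuxKernel P R K) {f : ℝ → ℝ}
    {a c : ℝ} (h : ∀ b ∈ Icc 0 R, P a b - f b ≤ c) : auxConj P R f a ≤ c := by
  refine csSup_le ⟨_, 0, ⟨le_rfl, hP.hR⟩, rfl⟩ ?_
  rintro _ ⟨b, hb, rfl⟩
  exact h b hb

theorem AuxKernel.conj_lip {P : ℝ → ℝ → ℝ} {R K : ℝ} (hP : AuxKernel P R K) {f : ℝ → ℝ}
    (hf : ∀ a ∈ Icc (0:ℝ) R, 0 ≤ f a) {a a' : ℝ} (ha : a ∈ Icc 0 R) (ha' : a' ∈ Icc 0 R) :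
    auxConj P R f a ≤ auxConj P R f a' + K * |a - a'| := by
  refine hP.conj_le fun b hb => ?_
  have h1 := (abs_le.1 (hP.lip a a' b ha ha' hb)).2
  have h2 := hP.le_conj hf ha' hb
  linarith

theorem AuxKernel.lipschitz_of_fixed {P : ℝ → ℝ → ℝ} {R K : ℝ} (hP : AuxKernel P R K)
    {f : ℝ → ℝ} (hf : ∀ a ∈ Icc (0:ℝ) R, 0 ≤ f a)
    (hfix : ∀ a ∈ Icc (0:ℝ) R, f a = auxConj P R f a) :
    LipschitzOnWith K.toNNReal f (Icc 0 R) := by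
  apply LipschitzOnWith.of_le_add_mul
  intro a ha a' ha'
  rw [hfix a ha, hfix a' ha', Real.coe_toNNReal _ hP.hK, Real.dist_eq]
  exact hP.conj_lip hf ha ha'

theorem AuxGood.conj_le {P : ℝ → ℝ → ℝ} {R K : ℝ} (hP : AuxKernel P R K) {f : ℝ → ℝ}
    (hf : AuxGood P R f) {a : ℝ} (ha : a ∈ Icc 0 R) : auxConj P R f a ≤ f a :=
  hP.conj_le fun b hb => by linarith [hf.adm a b ha hb]

theorem AuxGood.step {P : ℝ → ℝ → ℝ} {R K : ℝ} (hP : AuxKernel P R K) {f : ℝ → ℝ}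
    (hf : AuxGood P R f) : AuxGood P R (fun a => (f a + auxConj P R f a) / 2) := by
  have h0 : (0:ℝ) ∈ Icc 0 R := ⟨le_rfl, hP.hR⟩
  have hcn : ∀ a ∈ Icc (0:ℝ) R, 0 ≤ auxConj P R f a := by
    intro a ha
    have := hP.le_conj hf.nonneg ha h0
    rw [hP.zero, hf.zero] at this
    linarith
  refine ⟨fun a ha => ?_, fun a b ha hb => ?_, ?_⟩
  · have := hcn a ha
    have := hf.nonneg a ha
    positivity
  · have h1 := hP.le_conj hf.nonneg ha hb
    have h2 := hP.le_conj hf.nonneg hb ha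
    rw [hP.symm b a] at h2
    linarith
  · have h1 := hf.conj_le hP h0
    have h2 := hcn 0 h0
    have h3 := hf.zero
    linarith

theorem AuxGood.improve {P : ℝ → ℝ → ℝ} {R K : ℝ} (hP : AuxKernel P R K) {f : ℝ → ℝ}
    (hf : AuxGood P R f) : ∃ L, AuxGood P R L ∧ (∀ a ∈ Icc (0:ℝ) R, L a ≤ f a) ∧
      ∀ a ∈ Icc (0:ℝ) R, L a = auxConj P R L a := by
  set S : (ℝ → ℝ) → (ℝ → ℝ) := fun f a => (f a + auxConj P R f a) / 2 with hS
  set F : ℕ → ℝ → ℝ := fun n => S^[n] f with hF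
  have hFs : ∀ n a, F (n + 1) a = (F n a + auxConj P R (F n) a) / 2 := by
    intro n a
    simp only [hF, Function.iterate_succ_apply', hS]
  have hgood : ∀ n, AuxGood P R (F n) := by
    intro n
    induction n with
    | zero => exact hf
    | succ k ih =>
      have := ih.step hP
      have e : F (k + 1) = fun a => (F k a + auxConj P R (F k) a) / 2 := funext (hFs k)
      rw [e]; exact this
  have hanti : ∀ a ∈ Icc (0:ℝ) R, Antitone (fun n => F n a) := by
    intro a ha
    refine antitone_nat_of_succ_le fun n => ?_
    rw [hFs]
    linarith [(hgood n).conj_le hP ha]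
  have hbb : ∀ a ∈ Icc (0:ℝ) R, BddBelow (range fun n => F n a) := by
    intro a ha
    refine ⟨0, ?_⟩
    rintro _ ⟨n, rfl⟩
    exact (hgood n).nonneg a ha
  set L : ℝ → ℝ := fun a => ⨅ n, F n a with hL
  have hlim : ∀ a ∈ Icc (0:ℝ) R, Tendsto (fun n => F n a) atTop (𝓝 (L a)) := fun a ha =>
    tendsto_atTop_ciInf (hanti a ha) (hbb a ha)
  have hLle : ∀ n, ∀ a ∈ Icc (0:ℝ) R, L a ≤ F n a := fun n a ha => ciInf_le (hbb a ha) n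
  have hLgood : AuxGood P R L := by
    refine ⟨fun a ha => ?_, fun a b ha hb => ?_, ?_⟩
    · exact ge_of_tendsto' (hlim a ha) fun n => (hgood n).nonneg a ha
    · exact ge_of_tendsto' ((hlim a ha).add (hlim b hb)) fun n => (hgood n).adm a b ha hb
    · simp [hL, fun n => (hgood n).zero]
  refine ⟨L, hLgood, fun a ha => hLle 0 a ha, fun a ha => le_antisymm ?_ (hLgood.conj_le hP ha)⟩
  have hc : Tendsto (fun n => 2 * F (n + 1) a - F n a) atTop (𝓝 (2 * L a - L a)) :=
    (((tendsto_add_atTop_iff_nat 1).2 (hlim a ha)).const_mul 2).sub (hlim a ha)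
  have : 2 * L a - L a ≤ auxConj P R L a := by
    refine le_of_tendsto' hc fun n => ?_
    rw [hFs]
    have : auxConj P R (F n) a ≤ auxConj P R L a := by
      refine hP.conj_le fun b hb => ?_
      have h1 := hP.le_conj hLgood.nonneg ha hb
      have h2 := hLle n b hb
      linarith
    linarith
  linarith

theorem aux_arzela (R : ℝ) (K : NNReal) (M : ℝ) (G : ℕ → ℝ → ℝ)
    (hG : ∀ n, LipschitzOnWith K (G n) (Icc 0 R)) (hM : ∀ n, ∀ a ∈ Icc 0 R, G n a ∈ Icc 0 M) :
    ∃ (φ : ℕ → ℕ) (g : ℝ → ℝ), StrictMono φ ∧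
      ∀ a ∈ Icc (0:ℝ) R, Tendsto (fun n => G (φ n) a) atTop (𝓝 (g a)) := by
  have hl : ∀ n, LipschitzWith K ((Icc (0:ℝ) R).domRestrict (G n)) := fun n => (hG n).to_restrict
  set u : ℕ → BoundedContinuousFunction (Icc (0:ℝ) R) ℝ := fun n =>
    BoundedContinuousFunction.mkOfCompact ⟨(Icc (0:ℝ) R).domRestrict (G n), (hl n).continuous⟩ with hu
  have hcomp : IsCompact (closure (range u)) := by
    refine BoundedContinuousFunction.arzela_ascoli (Icc 0 M) isCompact_Icc (range u) ?_ ?_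
    · rintro _ x ⟨n, rfl⟩
      exact hM n x x.2
    · apply UniformEquicontinuous.equicontinuous
      apply LipschitzWith.uniformEquicontinuous _ K
      rintro ⟨_, n, rfl⟩
      exact hl n
  obtain ⟨g, -, φ, hφ, hlim⟩ := hcomp.tendsto_subseq (x := u)
    (fun n => subset_closure (mem_range_self n))
  refine ⟨φ, fun a => if h : a ∈ Icc (0:ℝ) R then g ⟨a, h⟩ else 0, hφ, fun a ha => ?_⟩
  simp only [dif_pos ha]
  have := (BoundedContinuousFunction.tendsto_iff_tendstoUniformly.1 hlim).tendsto_at ⟨a, ha⟩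
  exact this

theorem aux_ball_bound (f : ℝ → ℝ) (R : ℝ) (hR : 0 < R) (hf : ContinuousOn f (Icc 0 R))
    (hnn : ∀ a ∈ Icc (0:ℝ) R, 0 ≤ f a)
    (hfin : ∫⁻ z in closedBall (0:E3) R, ENNReal.ofReal (‖z‖ ^ (-7:ℝ) * f ‖z‖) ≠ ∞) :
    f 0 = 0 := by
  by_contra hne
  have h0 : 0 < f 0 := lt_of_le_of_ne (hnn 0 ⟨le_rfl, hR.le⟩) (Ne.symm hne)
  set c := f 0 / 2 with hc
  have hc0 : 0 < c := by positivity
  have hev : ∀ᶠ x in 𝓝[Icc 0 R] (0:ℝ), c < f x :=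
    (hf 0 ⟨le_rfl, hR.le⟩).eventually (lt_mem_nhds (by linarith))
  rw [eventually_nhdsWithin_iff, Metric.eventually_nhds_iff] at hev
  obtain ⟨δ, hδ, hδf⟩ := hev
  set I := ∫⁻ z in closedBall (0:E3) R, ENNReal.ofReal (‖z‖ ^ (-7:ℝ) * f ‖z‖) with hI
  set V := volume (ball (0:E3) 1) with hV
  have hV0 : V ≠ 0 := (measure_ball_pos volume (0:E3) one_pos).ne'
  have hVt : V ≠ ∞ := measure_ball_lt_top.ne
  -- lower bound from small balls
  have key : ∀ t : ℝ, 0 < t → t < δ → t ≤ R → ENNReal.ofReal (t ^ (-4:ℝ) * c) * V ≤ I := by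
    intro t ht htδ htR
    have hvol : volume (ball (0:E3) t \ {0}) = ENNReal.ofReal (t ^ 3) * V := by
      rw [measure_diff_null (by simp), Measure.addHaar_ball _ _ ht.le]
      simp [hV]
    have h1 : ENNReal.ofReal (t ^ (-7:ℝ) * c) * volume (ball (0:E3) t \ {0}) ≤ I := by
      rw [← setLIntegral_const]
      calc _ ≤ ∫⁻ z in ball (0:E3) t \ {0}, ENNReal.ofReal (‖z‖ ^ (-7:ℝ) * f ‖z‖) := by
            refine setLIntegral_mono' (measurableSet_ball.diff (measurableSet_singleton _)) ?_
            rintro z ⟨hz, hz0⟩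
            have hz1 : ‖z‖ < t := by simpa using hz
            have hz2 : 0 < ‖z‖ := norm_pos_iff.2 hz0
            apply ENNReal.ofReal_le_ofReal
            have h2 : t ^ (-7:ℝ) ≤ ‖z‖ ^ (-7:ℝ) :=
              Real.rpow_le_rpow_of_nonpos hz2 hz1.le (by norm_num)
            have h3 : c < f ‖z‖ := hδf (by
              rw [Real.dist_eq, sub_zero, abs_of_pos hz2]; linarith) ⟨hz2.le, by linarith⟩
            have h4 : 0 ≤ t ^ (-7:ℝ) := by positivity
            exact mul_le_mul h2 h3.le hc0.le (h4.trans h2)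
        _ ≤ I := by
            refine lintegral_mono_set ?_
            intro z hz
            exact closedBall_subset_closedBall htR (ball_subset_closedBall hz.1)
    rw [hvol, ← mul_assoc, ← ENNReal.ofReal_mul (by positivity)] at h1
    have h5 : t ^ (-7:ℝ) * c * t ^ 3 = t ^ (-4:ℝ) * c := by
      have : t ^ (-4:ℝ) = t ^ (-7:ℝ) * t ^ 3 := by
        rw [← Real.rpow_natCast, ← Real.rpow_add ht]; norm_num
      rw [this]; ring
    rwa [h5] at h1
  have htend : Tendsto (fun t : ℝ => ENNReal.ofReal (t ^ (-4:ℝ) * c) * V) (𝓝[>] 0) (𝓝 ∞) := by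
    have h1 : Tendsto (fun t : ℝ => t ^ (-4:ℝ) * c) (𝓝[>] 0) atTop :=
      (tendsto_rpow_neg_nhdsGT_zero (by norm_num)).atTop_mul_const hc0
    have h2 := ENNReal.Tendsto.mul_const (ENNReal.tendsto_ofReal_nhds_top.2 h1)
      (b := V) (Or.inr hVt)
    rw [ENNReal.top_mul hV0] at h2
    exact h2
  have hle : ∞ ≤ I := by
    refine le_of_tendsto htend ?_
    have e1 : ∀ᶠ t : ℝ in 𝓝[>] 0, t < min δ R :=
      (eventually_lt_nhds (lt_min hδ hR)).filter_mono nhdsWithin_le_nhds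
    filter_upwards [e1, self_mem_nhdsWithin] with t ht ht0
    exact key t ht0 (ht.trans_le (min_le_left _ _)) (ht.le.trans (min_le_right _ _))
  exact hfin (top_le_iff.1 hle)

theorem aux_int_finite (R : ℝ) :
    ∫⁻ z in closedBall (0:E3) R, ENNReal.ofReal (‖z‖ ^ (-7:ℝ) * ‖z‖ ^ 6) ≠ ∞ := by
  have h1 : Integrable (fun z : E3 => (Ioc (0:ℝ) R).indicator (fun r => r⁻¹) ‖z‖) := by
    rw [integrable_fun_norm_addHaar volume]
    have : IntegrableOn ((Ioc (0:ℝ) R).indicator (fun r => r)) (Ioi 0) := by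
      rw [integrableOn_indicator_iff measurableSet_Ioc]
      exact (continuous_id.integrableOn_Icc.mono_set
        (inter_subset_left.trans Ioc_subset_Icc_self))
    refine this.congr_fun (fun r hr => ?_) measurableSet_Ioi
    have hr' : (0:ℝ) < r := hr
    simp only [indicator, finrank_euclideanSpace, Fintype.card_fin]
    split_ifs
    · simp; field_simp
    · simp
  have h2 := h1.lintegral_lt_top
  refine ne_of_lt (lt_of_le_of_lt ?_ h2)
  rw [← lintegral_indicator measurableSet_closedBall]
  refine lintegral_mono fun z => ?_
  by_cases hz : z ∈ closedBall (0:E3) R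
  · rw [indicator_of_mem hz]
    apply ENNReal.ofReal_le_ofReal
    by_cases hz0 : z = 0
    · simp [hz0]
    · have hz2 : 0 < ‖z‖ := norm_pos_iff.2 hz0
      have : ‖z‖ ∈ Ioc 0 R := ⟨hz2, by simpa using hz⟩
      rw [indicator_of_mem this, ← Real.rpow_natCast, ← Real.rpow_add hz2, ← Real.rpow_neg_one]
      norm_num
  · rw [indicator_of_notMem hz]
    exact zero_le

theorem aux_Psi_kernel (R : ℝ) (hR : 2 ≤ R)
    (μ ν : Measure E3) [IsProbabilityMeasure μ] [IsProbabilityMeasure ν]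
    (hμ : IsRadial μ) (hν : IsRadial ν) : AuxKernel (Psi μ ν) R (15 * R ^ 5) := by
  refine ⟨by linarith, by positivity, fun a b => ?_, fun a => ?_, fun a a' b ha ha' hb => ?_⟩
  · unfold Psi
    rw [aux_Phi_symm μ ν hμ hν a b, aux_Phi_symm ν μ hν hμ a b, aux_Phi_symm ν ν hν hν a b]
    ring
  · simp [Psi, aux_Phi_zero_right]
  · have h1 := abs_le.1 (aux_Phi_lip μ ν hμ hν R a a' b ha ha' hb)
    have h2 := abs_le.1 (aux_Phi_lip ν μ hν hμ R a a' b ha ha' hb)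
    have h3 := abs_le.1 (aux_Phi_lip ν ν hν hν R a a' b ha ha' hb)
    unfold Psi
    rw [abs_le]
    constructor <;> linarith [h1.1, h1.2, h2.1, h2.2, h3.1, h3.2]

/-- **Existence of an optimizer for `I_R(μ,ν)`** (Theorem 3 of the paper): for `R ≥ 2` and
radial probability measures supported in the unit ball with `μ({0}) = 0`, the truncated
problem `I_R(μ,ν)` admits a Lipschitz-continuous minimizer `f ∈ 𝓕_{μν,R}` satisfying the
fixed-point equation `f(a) = max_{b∈[0,R]} {Ψ_{μν}(a,b) - f(b)}` and `0 ≤ f ≤ g` on `[2,R]`. -/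
theorem existence_optimizer_IR (R : ℝ) (hR : 2 ≤ R)
    (μ ν : Measure E3) [IsProbabilityMeasure μ] [IsProbabilityMeasure ν]
    (hμrad : IsRadial μ) (hνrad : IsRadial ν)
    (hμs : μ (closedBall (0:E3) 1)ᶜ = 0) (hνs : ν (closedBall (0:E3) 1)ᶜ = 0)
    (hμ0 : μ {0} = 0) :
    ∃ f ∈ FFR μ ν R,
      (∃ K : NNReal, LipschitzOnWith K f (Icc 0 R)) ∧
      (∫⁻ z in closedBall (0:E3) R, ENNReal.ofReal (‖z‖ ^ (-7:ℝ) * f ‖z‖)) = IIR μ ν R ∧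
      (∀ a ∈ Icc (0:ℝ) R, f a = sSup ((fun b => Psi μ ν a b - f b) '' Icc 0 R)) ∧
      ∀ a ∈ Icc (2:ℝ) R, 0 ≤ f a ∧ f a ≤ gPsi μ ν a := by
  have hR0 : 0 < R := by linarith
  have hP := aux_Psi_kernel R hR μ ν hμrad hνrad
  set K : ℝ := 15 * R ^ 5 with hK
  set J : (ℝ → ℝ) → ℝ≥0∞ := fun f =>
    ∫⁻ z in closedBall (0:E3) R, ENNReal.ofReal (‖z‖ ^ (-7:ℝ) * f ‖z‖) with hJ
  have hIIR : IIR μ ν R = ⨅ f ∈ FFR μ ν R, J f := rfl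
  have hmem : ∀ z ∈ closedBall (0:E3) R, ‖z‖ ∈ Icc 0 R := fun z hz =>
    ⟨norm_nonneg z, by simpa using hz⟩
  have hJmono : ∀ f g : ℝ → ℝ, (∀ a ∈ Icc (0:ℝ) R, f a ≤ g a) → J f ≤ J g := by
    intro f g hfg
    refine setLIntegral_mono' measurableSet_closedBall fun z hz => ?_
    apply ENNReal.ofReal_le_ofReal
    exact mul_le_mul_of_nonneg_left (hfg _ (hmem z hz)) (by positivity)
  -- from a good fixed point to an element of the class
  have hgoodF : ∀ L, AuxGood (Psi μ ν) R L →
      (∀ a ∈ Icc (0:ℝ) R, L a = auxConj (Psi μ ν) R L a) → L ∈ FFR μ ν R := fun L hL hfix =>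
    ⟨(hP.lipschitz_of_fixed hL.nonneg hfix).continuousOn, hL.nonneg, hL.adm⟩
  -- finiteness
  have h6 : (fun a : ℝ => a ^ 6) ∈ FFR μ ν R := by
    refine ⟨by fun_prop, fun a ha => by positivity, fun a b ha hb => ?_⟩
    have h1 := aux_Phi_bounds μ ν hμrad hνrad a b ha.1 hb.1
    have h2 := aux_Phi_bounds ν μ hνrad hμrad a b ha.1 hb.1
    have h3 := aux_Phi_bounds ν ν hνrad hνrad a b ha.1 hb.1
    unfold Psi
    nlinarith [sq_nonneg (a ^ 3 - b ^ 3), h1.2, h2.2, h3.1]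
  have hfin : IIR μ ν R ≠ ∞ := by
    rw [hIIR]
    exact ne_top_of_le_ne_top (aux_int_finite R) (iInf₂_le _ h6)
  -- minimizing sequence of fixed points
  have hseq : ∀ n : ℕ, ∃ L, AuxGood (Psi μ ν) R L ∧
      (∀ a ∈ Icc (0:ℝ) R, L a = auxConj (Psi μ ν) R L a) ∧
      J L ≤ IIR μ ν R + ((n:ℝ≥0∞) + 1)⁻¹ := by
    intro n
    have hlt : IIR μ ν R < IIR μ ν R + ((n:ℝ≥0∞) + 1)⁻¹ :=
      ENNReal.lt_add_right hfin (by simp)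
    conv_lhs at hlt => rw [hIIR]
    simp only [iInf_lt_iff] at hlt
    obtain ⟨f, hf, hfJ⟩ := hlt
    have hf0 : f 0 = 0 := aux_ball_bound f R hR0 hf.1 hf.2.1 (ne_top_of_lt hfJ)
    obtain ⟨L, hL, hLf, hfix⟩ := AuxGood.improve hP (f := f) ⟨hf.2.1, hf.2.2, hf0⟩
    exact ⟨L, hL, hfix, (hJmono L f hLf).trans hfJ.le⟩
  choose G hGood hGfix hGJ using hseq
  have hGlip : ∀ n, LipschitzOnWith K.toNNReal (G n) (Icc 0 R) := fun n =>
    hP.lipschitz_of_fixed (hGood n).nonneg (hGfix n)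
  have hGM : ∀ n, ∀ a ∈ Icc 0 R, G n a ∈ Icc 0 (K * R) := by
    intro n a ha
    refine ⟨(hGood n).nonneg a ha, ?_⟩
    rw [hGfix n a ha]
    exact hP.conj_le fun b hb => by linarith [hP.bdd ha hb, (hGood n).nonneg b hb]
  obtain ⟨φ, g, hφ, hlim⟩ := aux_arzela R K.toNNReal (K * R) G hGlip hGM
  have h0mem : (0:ℝ) ∈ Icc 0 R := ⟨le_rfl, hR0.le⟩
  have hggood : AuxGood (Psi μ ν) R g := by
    refine ⟨fun a ha => ?_, fun a b ha hb => ?_, ?_⟩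
    · exact ge_of_tendsto' (hlim a ha) fun n => (hGood _).nonneg a ha
    · exact ge_of_tendsto' ((hlim a ha).add (hlim b hb)) fun n => (hGood _).adm a b ha hb
    · refine tendsto_nhds_unique (hlim 0 h0mem) ?_
      simp [fun n => (hGood n).zero]
  have hgJ : J g ≤ IIR μ ν R := by
    have hFatou : J g ≤ liminf (fun n => J (G (φ n))) atTop := by
      refine le_trans ?_ (lintegral_liminf_le' (μ := volume.restrict (closedBall (0:E3) R))
        (f := fun n (z : E3) => ENNReal.ofReal (‖z‖ ^ (-7:ℝ) * G (φ n) ‖z‖)) fun n => ?_)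
      · refine setLIntegral_mono_ae' measurableSet_closedBall (ae_of_all _ fun z hz => ?_)
        have ht : Tendsto (fun n => ENNReal.ofReal (‖z‖ ^ (-7:ℝ) * G (φ n) ‖z‖)) atTop
            (𝓝 (ENNReal.ofReal (‖z‖ ^ (-7:ℝ) * g ‖z‖))) :=
          ENNReal.tendsto_ofReal ((hlim _ (hmem z hz)).const_mul _)
        exact ht.liminf_eq.ge
      · have hc : ContinuousOn (fun z : E3 => G (φ n) ‖z‖) (closedBall 0 R) :=
          (hGlip (φ n)).continuousOn.comp continuous_norm.continuousOn hmem
        have hm : AEMeasurable (fun z : E3 => ‖z‖ ^ (-7:ℝ))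
            (volume.restrict (closedBall (0:E3) R)) := by fun_prop
        exact (hm.mul (hc.aemeasurable measurableSet_closedBall)).ennreal_ofReal
    refine hFatou.trans ?_
    have hb : Tendsto (fun n : ℕ => IIR μ ν R + ((φ n : ℝ≥0∞) + 1)⁻¹) atTop
        (𝓝 (IIR μ ν R + 0)) := by
      refine Tendsto.const_add _ ?_
      have h1 : Tendsto (fun n : ℕ => ((n : ℝ≥0∞) + 1)⁻¹) atTop (𝓝 0) := by
        have := (tendsto_add_atTop_iff_nat 1).2 ENNReal.tendsto_inv_nat_nhds_zero
        simpa using this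
      exact h1.comp hφ.tendsto_atTop
    rw [add_zero] at hb
    rw [← hb.liminf_eq]
    exact liminf_le_liminf (Eventually.of_forall fun n => hGJ (φ n))
  obtain ⟨f, hfgood, hfg, hfix⟩ := hggood.improve hP
  have hfF := hgoodF f hfgood hfix
  refine ⟨f, hfF, ⟨K.toNNReal, hP.lipschitz_of_fixed hfgood.nonneg hfix⟩, ?_, hfix, ?_⟩
  · refine le_antisymm ((hJmono f g hfg).trans hgJ) ?_
    rw [hIIR]
    exact iInf₂_le f hfF
  · intro a ha
    have haI : a ∈ Icc 0 R := ⟨by linarith [ha.1], ha.2⟩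
    refine ⟨hfgood.nonneg a haI, ?_⟩
    have hbdd : BddAbove ((fun b => Psi μ ν a b - max (Psi μ ν b b) 0 / 2) '' Icc 0 a) := by
      refine ⟨K * R, ?_⟩
      rintro _ ⟨b, hb, rfl⟩
      have h1 := hP.bdd haI (b := b) ⟨hb.1, hb.2.trans ha.2⟩
      have h2 : 0 ≤ max (Psi μ ν b b) 0 := le_max_right _ _
      simp only
      linarith
    rw [hfix a haI]
    refine hP.conj_le fun b hb => ?_
    by_cases hba : b ≤ a
    · refine le_trans ?_ (le_csSup hbdd ⟨b, ⟨hb.1, hba⟩, rfl⟩)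
      have h1 := hfgood.adm b b hb hb
      have h2 := hfgood.nonneg b hb
      have h3 : max (Psi μ ν b b) 0 / 2 ≤ f b := by
        have : max (Psi μ ν b b) 0 ≤ 2 * f b := max_le (by linarith) (by linarith)
        linarith
      simp only
      linarith
    · push Not at hba
      have h2b : 2 ≤ b := ha.1.trans hba.le
      have hz : Psi μ ν a b = 0 := by
        unfold Psi
        rw [aux_Phi_far μ ν hμrad hνrad hμs hνs a b ha.1 h2b,
          aux_Phi_far ν μ hνrad hμrad hνs hμs a b ha.1 h2b,
          aux_Phi_far ν ν hνrad hνrad hνs hνs a b ha.1 h2b]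
        ring
      have h1 : (0:ℝ) ≤ gPsi μ ν a := by
        refine le_csSup hbdd ⟨0, ⟨le_rfl, haI.1⟩, ?_⟩
        simp [hP.zero]
      rw [hz]
      linarith [hfgood.nonneg b hb]
end
end

section
/- Let μ be a radial Borel probability measure on ℝ³ with compact support and D(μ,μ) < ∞, let χ(a) := a³(1 − a V_μ(a e₁)) for a ≥ 0, and let ζ be the smallest non-decreasing function on [0,∞) with ζ ≥ χ. Then ζ is bounded and continuous with ζ(a) ~ a³ as a → 0, and the function f(a) := a³ ζ(a) belongs to 𝓕_{μδ₀}, i.e. Ψ_{μδ₀}(a,b) ≤ f(a) + f(b) for all a,b ≥ 0, where Ψ_{μδ₀}(a,b) = a³b³(2 − a V_μ(a e₁) − b V_μ(b e₁)). -/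
open MeasureTheory ENNReal Set Metric Filter Real Topology
open scoped RealInnerProductSpace

noncomputable section

/-- The Coulomb potential `V_μ = μ ∗ |·|⁻¹` generated by `μ`. -/
def Vpot (μ : Measure E3) (x : E3) : ℝ := (∫⁻ y, coul x y ∂μ).toReal

/-- Coordinates `E3 ≃ ℝ × ℝ × ℝ` preserve volume. -/
lemma mp_coord : MeasurePreserving (fun z : E3 => ((z 0, (z 1, z 2)) : ℝ × (ℝ × ℝ))) volume volume := by
  have h1 : MeasurePreserving (@WithLp.ofLp 2 (Fin 3 → ℝ)) := PiLp.volume_preserving_ofLp (Fin 3)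
  have h2 := volume_preserving_piFinSuccAbove (fun _ : Fin 3 => ℝ) 0
  have h3 : MeasurePreserving (Prod.map (id : ℝ → ℝ) (@MeasurableEquiv.finTwoArrow ℝ _))
      volume volume :=
    (MeasurePreserving.id (volume : Measure ℝ)).prod (volume_preserving_finTwoArrow ℝ)
  exact h3.comp (h2.comp h1)

lemma norm_E3 (z : E3) : ‖z‖ = √((z 0) ^ 2 + ((z 1) ^ 2 + (z 2) ^ 2)) := by
  rw [EuclideanSpace.norm_eq, Fin.sum_univ_three]
  simp [add_assoc]

lemma lint_polar (f : ℝ × ℝ → ℝ≥0∞) (hf : Measurable f) :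
    ∫⁻ p, f p = ∫⁻ r in Ioi (0:ℝ), ∫⁻ θ in Ioo (-π) π,
      ENNReal.ofReal r * f (r * cos θ, r * sin θ) := by
  rw [← lintegral_comp_polarCoord_symm]
  simp only [polarCoord_target, polarCoord_symm_apply, smul_eq_mul]
  rw [Measure.volume_eq_prod, ← Measure.prod_restrict, lintegral_prod]
  apply Measurable.aemeasurable
  fun_prop

lemma sph_int (H : ℝ × ℝ → ℝ≥0∞) (hH : Measurable H) :
    ∫⁻ z : E3, H (z 0, ‖z‖) = ∫⁻ r in Ioi (0:ℝ), ∫⁻ θ in Ioo (0:ℝ) π,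
      ENNReal.ofReal (2 * π) * (ENNReal.ofReal r * (ENNReal.ofReal (r * sin θ) *
        H (r * cos θ, r))) := by
  have e1 : ∫⁻ z : E3, H (z 0, ‖z‖)
      = ∫⁻ q : ℝ × (ℝ × ℝ), H (q.1, √(q.1 ^ 2 + (q.2.1 ^ 2 + q.2.2 ^ 2))) := by
    rw [← mp_coord.lintegral_comp (by fun_prop)]
    simp only [norm_E3]
  rw [e1, Measure.volume_eq_prod, lintegral_prod _ (by fun_prop)]
  have e2 : ∀ t : ℝ, ∫⁻ p : ℝ × ℝ, H (t, √(t ^ 2 + (p.1 ^ 2 + p.2 ^ 2)))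
      = ∫⁻ ρ : ℝ, ENNReal.ofReal (2 * π) * (ENNReal.ofReal ρ * H (t, √(t ^ 2 + ρ ^ 2))) := by
    intro t
    rw [lint_polar _ (by fun_prop)]
    have : ∀ r θ : ℝ, (r * cos θ) ^ 2 + (r * sin θ) ^ 2 = r ^ 2 := by
      intro r θ
      linear_combination r ^ 2 * sin_sq_add_cos_sq θ
    simp only [this, lintegral_const, Measure.restrict_apply_univ, Real.volume_Ioo]
    rw [← lintegral_indicator measurableSet_Ioi]
    congr 1
    ext ρ
    by_cases h : 0 < ρ
    · rw [indicator_of_mem (by exact h), mul_comm]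
      congr 2
      ring
    · rw [indicator_of_notMem (by exact h), ENNReal.ofReal_of_nonpos (not_lt.1 h)]
      simp
  simp only [e2]
  rw [← lintegral_prod (f := fun q : ℝ × ℝ => ENNReal.ofReal (2 * π) * (ENNReal.ofReal q.2 * H (q.1, √(q.1 ^ 2 + q.2 ^ 2)))) (by fun_prop),
    ← Measure.volume_eq_prod, lint_polar _ (by fun_prop)]
  apply setLIntegral_congr_fun measurableSet_Ioi
  intro r hr
  have hr : 0 < r := hr
  simp only
  have h3 : ∀ θ : ℝ, √((r * cos θ) ^ 2 + (r * sin θ) ^ 2) = r := by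
    intro θ
    rw [show (r * cos θ) ^ 2 + (r * sin θ) ^ 2 = r ^ 2 by
      linear_combination r ^ 2 * sin_sq_add_cos_sq θ]
    exact sqrt_sq hr.le
  simp only [h3]
  rw [← lintegral_indicator measurableSet_Ioo, ← lintegral_indicator measurableSet_Ioo]
  congr 1
  ext θ
  by_cases h : θ ∈ Ioo (0:ℝ) π
  · rw [indicator_of_mem h, indicator_of_mem (show θ ∈ Ioo (-π) π from ⟨by linarith [h.1, pi_pos], h.2⟩)]
    ring
  · rw [indicator_of_notMem h]
    by_cases h' : θ ∈ Ioo (-π) π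
    · rw [indicator_of_mem h', ENNReal.ofReal_of_nonpos (p := r * sin θ)]
      · simp
      · have : θ ≤ 0 := by
          by_contra h0
          exact h ⟨not_le.1 h0, h'.2⟩
        exact mul_nonpos_of_nonneg_of_nonpos hr.le
          (sin_nonpos_of_nonpos_of_neg_pi_le this h'.1.le)
    · rw [indicator_of_notMem h']

/-- Archimedes: integrals over the ball of functions of the angle. -/
lemma archimedes : ∃ C : ℝ≥0∞, ∀ g : ℝ → ℝ≥0∞, Measurable g →
    ∫⁻ z in ball (0:E3) 1, g (z 0 / ‖z‖) =
      C * ∫⁻ θ in Ioo (0:ℝ) π, ENNReal.ofReal (sin θ) * g (cos θ) := by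
  refine ⟨∫⁻ r in Ioi (0:ℝ), ENNReal.ofReal (2 * π) * (ENNReal.ofReal r * ENNReal.ofReal r) *
    (Iio (1:ℝ)).indicator 1 r, fun g hg => ?_⟩
  have hi : Measurable ((Iio (1:ℝ)).indicator (1 : ℝ → ℝ≥0∞)) :=
    measurable_one.indicator measurableSet_Iio
  have h1 : ∫⁻ z in ball (0:E3) 1, g (z 0 / ‖z‖)
      = ∫⁻ z : E3, (fun p : ℝ × ℝ => (Iio (1:ℝ)).indicator 1 p.2 * g (p.1 / p.2)) (z 0, ‖z‖) := by
    rw [← lintegral_indicator measurableSet_ball]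
    congr 1
    ext z
    by_cases h : ‖z‖ < 1
    · rw [indicator_of_mem (by simpa using h)]
      simp [h]
    · rw [indicator_of_notMem (by simpa using h)]
      simp [h]
  rw [h1, sph_int (fun p : ℝ × ℝ => (Iio (1:ℝ)).indicator 1 p.2 * g (p.1 / p.2)) (by fun_prop),
    ← lintegral_mul_const _ (by fun_prop)]
  apply setLIntegral_congr_fun measurableSet_Ioi
  intro r hr
  have hr : 0 < r := hr
  simp only
  rw [← lintegral_const_mul _ (by fun_prop)]
  congr 1
  ext θ
  rw [ENNReal.ofReal_mul hr.le, mul_div_cancel_left₀ _ hr.ne']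
  ring

lemma angle_int (a r : ℝ) (ha : 0 < a) (hr : 0 ≤ r) :
    ∫⁻ θ in Ioo (0:ℝ) π, ENNReal.ofReal (sin θ) *
      (ENNReal.ofReal √(a ^ 2 + r ^ 2 - 2 * a * r * cos θ))⁻¹ =
      2 * (ENNReal.ofReal (max a r))⁻¹ := by
  have key : ∀ (F F' : ℝ → ℝ) (c : ℝ), Continuous F →
      (∀ θ ∈ Ioo (0:ℝ) π, HasDerivAt F (F' θ) θ) → (∀ θ ∈ Ioo (0:ℝ) π, 0 ≤ F' θ) →
      F π - F 0 = c → ∫⁻ θ in Ioo (0:ℝ) π, ENNReal.ofReal (F' θ) = ENNReal.ofReal c := by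
    intro F F' c hF hd hp hc
    have hFint := intervalIntegral.integrableOn_deriv_of_nonneg hF.continuousOn hd hp
    have := intervalIntegral.integral_eq_sub_of_hasDerivAt_of_le pi_pos.le hF.continuousOn hd
      ((intervalIntegrable_iff_integrableOn_Ioc_of_le pi_pos.le).2 hFint)
    rw [intervalIntegral.integral_of_le pi_pos.le, integral_Ioc_eq_integral_Ioo, hc] at this
    rw [← this, ofReal_integral_eq_lintegral_ofReal (hFint.mono_set Ioo_subset_Ioc_self)]
    exact (ae_restrict_iff' measurableSet_Ioo).2 (Eventually.of_forall hp)
  have hmax : 0 < max a r := lt_max_of_lt_left ha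
  have hpos : ∀ θ ∈ Ioo (0:ℝ) π, 0 < a ^ 2 + r ^ 2 - 2 * a * r * cos θ := by
    intro θ hθ
    have hs := sin_pos_of_pos_of_lt_pi hθ.1 hθ.2
    have h1 := sin_sq_add_cos_sq θ
    have : a ^ 2 + r ^ 2 - 2 * a * r * cos θ = (r - a * cos θ) ^ 2 + (a * sin θ) ^ 2 := by
      linear_combination (-a ^ 2) * h1
    rw [this]
    positivity
  have hrw : ∫⁻ θ in Ioo (0:ℝ) π, ENNReal.ofReal (sin θ) *
      (ENNReal.ofReal √(a ^ 2 + r ^ 2 - 2 * a * r * cos θ))⁻¹ =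
      ∫⁻ θ in Ioo (0:ℝ) π, ENNReal.ofReal (sin θ / √(a ^ 2 + r ^ 2 - 2 * a * r * cos θ)) := by
    apply setLIntegral_congr_fun measurableSet_Ioo
    intro θ hθ
    have hs := sin_pos_of_pos_of_lt_pi hθ.1 hθ.2
    simp only
    rw [div_eq_mul_inv, ENNReal.ofReal_mul hs.le,
      ENNReal.ofReal_inv_of_pos (sqrt_pos.2 (hpos θ hθ))]
  have hfin : (2 : ℝ≥0∞) * (ENNReal.ofReal (max a r))⁻¹ = ENNReal.ofReal (2 / max a r) := by
    rw [div_eq_mul_inv, ENNReal.ofReal_mul (by norm_num), ENNReal.ofReal_inv_of_pos hmax]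
    simp
  rw [hrw, hfin]
  rcases hr.eq_or_lt with rfl | hr
  · apply key (fun θ => - cos θ / a)
    · fun_prop
    · intro θ hθ
      have := ((hasDerivAt_cos θ).neg).div_const a
      refine this.congr_deriv ?_
      simp [sqrt_sq ha.le]
    · intro θ hθ
      have hs := sin_pos_of_pos_of_lt_pi hθ.1 hθ.2
      positivity
    · simp [max_eq_left ha.le]
      ring
  · apply key (fun θ => √(a ^ 2 + r ^ 2 - 2 * a * r * cos θ) / (a * r))
    · fun_prop
    · intro θ hθ
      have := ((((hasDerivAt_cos θ).const_mul (2 * a * r)).const_sub (a ^ 2 + r ^ 2)).sqrt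
        (hpos θ hθ).ne').div_const (a * r)
      refine this.congr_deriv ?_
      have := (sqrt_pos.2 (hpos θ hθ)).ne'
      field_simp
    · intro θ hθ
      have hs := sin_pos_of_pos_of_lt_pi hθ.1 hθ.2
      positivity
    · simp only [cos_pi, cos_zero]
      rw [show a ^ 2 + r ^ 2 - 2 * a * r * -1 = (a + r) ^ 2 by ring,
        show a ^ 2 + r ^ 2 - 2 * a * r * 1 = (a - r) ^ 2 by ring, sqrt_sq_eq_abs, sqrt_sq_eq_abs,
        abs_of_pos (by positivity : 0 < a + r)]
      rcases le_total a r with h | h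
      · rw [abs_of_nonpos (by linarith), max_eq_right h]
        field_simp
        ring
      · rw [abs_of_nonneg (by linarith), max_eq_left h]
        field_simp
        ring

lemma norm_e1 : ‖e1‖ = 1 := by simp [e1]

lemma exists_rot (x y : E3) (h : ‖x‖ = ‖y‖) : ∃ e : E3 ≃ₗᵢ[ℝ] E3, e x = y :=
  ⟨_, Submodule.reflection_sub h⟩

lemma coul_rot (e : E3 ≃ₗᵢ[ℝ] E3) (x y : E3) : coul (e x) (e y) = coul x y := by
  rw [coul, coul, ← map_sub, e.norm_map]

lemma measurable_coul : Measurable (fun p : E3 × E3 => coul p.1 p.2) := by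
  unfold coul
  fun_prop

lemma measurable_coul_right (x : E3) : Measurable (coul x) := by
  unfold coul
  fun_prop

lemma pot_rot (μ : Measure E3) (hμrad : IsRadial μ) (e : E3 ≃ₗᵢ[ℝ] E3) (x : E3) :
    ∫⁻ y, coul (e x) y ∂μ = ∫⁻ y, coul x y ∂μ := by
  conv_lhs => rw [← hμrad e]
  rw [lintegral_map (measurable_coul_right _) e.continuous.measurable]
  simp only [coul_rot]

lemma norm_ray (a r : ℝ) (w : E3) (hw : ‖w‖ = 1) :
    ‖a • w - r • e1‖ = √(a ^ 2 + r ^ 2 - 2 * a * r * w 0) := by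
  rw [← sqrt_sq (norm_nonneg (a • w - r • e1)), norm_sub_sq_real, norm_smul, norm_smul, norm_e1, hw,
    inner_smul_left, inner_smul_right]
  congr 1
  have : ⟪w, e1⟫ = w 0 := by simp [e1, EuclideanSpace.inner_single_right]
  rw [this]
  simp
  ring

lemma avg_coul : ∃ C : ℝ≥0∞, volume (ball (0:E3) 1) = C ∧ ∀ (a : ℝ) (y : E3), 0 < a →
    ∫⁻ z in ball (0:E3) 1, coul (a • (‖z‖⁻¹ • z)) y = C * (ENNReal.ofReal (max a ‖y‖))⁻¹ := by
  obtain ⟨C, hC⟩ := archimedes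
  refine ⟨C * 2, ?_, fun a y ha => ?_⟩
  · have h1 := hC (fun _ => 1) measurable_const
    have h2 := angle_int 1 0 one_pos le_rfl
    simp only [lintegral_const, Measure.restrict_apply_univ, one_mul, mul_one] at h1
    simp at h2
    rw [h1, h2]
  · obtain ⟨e, he⟩ := exists_rot y (‖y‖ • e1) (by simp [norm_smul, norm_e1])
    have h1 : ∫⁻ z in ball (0:E3) 1, coul (a • (‖z‖⁻¹ • z)) y
        = ∫⁻ z in ball (0:E3) 1, coul (a • (‖z‖⁻¹ • z)) (‖y‖ • e1) := by
      rw [← (e.measurePreserving).setLIntegral_comp_preimage measurableSet_ball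
        (f := fun z => coul (a • (‖z‖⁻¹ • z)) (‖y‖ • e1)) (by unfold coul; fun_prop)]
      have : e ⁻¹' ball 0 1 = ball 0 1 := by
        ext z
        simp
      rw [this]
      congr 1
      ext z
      rw [← he, ← coul_rot e]
      simp
    have h2 : ∫⁻ z in ball (0:E3) 1, coul (a • (‖z‖⁻¹ • z)) (‖y‖ • e1)
        = ∫⁻ z in ball (0:E3) 1,
          (fun t => (ENNReal.ofReal √(a ^ 2 + ‖y‖ ^ 2 - 2 * a * ‖y‖ * t))⁻¹) (z 0 / ‖z‖) := by
      apply lintegral_congr_ae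
      apply ae_restrict_of_ae
      have : ∀ᵐ z : E3, z ≠ 0 := by
        simp [ae_iff]
      filter_upwards [this] with z hz
      rw [coul, norm_ray _ _ _ (by simp [norm_smul, hz])]
      simp [div_eq_inv_mul]
    rw [h1, h2, hC (fun t => (ENNReal.ofReal √(a ^ 2 + ‖y‖ ^ 2 - 2 * a * ‖y‖ * t))⁻¹) (by fun_prop),
      angle_int a ‖y‖ ha (norm_nonneg y), mul_assoc]

/-- Newton's theorem. -/
lemma newton (μ : Measure E3) [IsProbabilityMeasure μ] (hμrad : IsRadial μ) (a : ℝ) (ha : 0 < a) :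
    ∫⁻ y, coul (a • e1) y ∂μ = ∫⁻ y, (ENNReal.ofReal (max a ‖y‖))⁻¹ ∂μ := by
  obtain ⟨C, hC, h⟩ := avg_coul
  have hC0 : C ≠ 0 := hC ▸ (measure_ball_pos volume (0:E3) one_pos).ne'
  have hCt : C ≠ ⊤ := hC ▸ measure_ball_lt_top.ne
  have h1 : ∫⁻ z in ball (0:E3) 1, ∫⁻ y, coul (a • (‖z‖⁻¹ • z)) y ∂μ
      = C * ∫⁻ y, coul (a • e1) y ∂μ := by
    have : ∫⁻ z in ball (0:E3) 1, ∫⁻ y, coul (a • (‖z‖⁻¹ • z)) y ∂μ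
       = ∫⁻ z in ball (0:E3) 1, ∫⁻ y, coul (a • e1) y ∂μ := by
      apply lintegral_congr_ae
      apply ae_restrict_of_ae
      have : ∀ᵐ z : E3, z ≠ 0 := by
        simp [ae_iff]
      filter_upwards [this] with z hz
      obtain ⟨e, he⟩ := exists_rot (a • e1) (a • (‖z‖⁻¹ • z)) (by simp [norm_smul, norm_e1, hz])
      rw [← he, pot_rot μ hμrad]
    rw [this, lintegral_const, Measure.restrict_apply_univ, hC, mul_comm]
  rw [lintegral_lintegral_swap] at h1
  · simp only [h a _ ha] at h1
    rw [lintegral_const_mul _ (by fun_prop)] at h1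
    exact ((ENNReal.mul_right_inj hC0 hCt).1 h1).symm
  · apply Measurable.aemeasurable
    unfold coul Function.uncurry
    fun_prop

/-- `a V_μ(a e₁)` in closed form. -/
def mm (μ : Measure E3) (a : ℝ) : ℝ := ∫ y, |a| / max |a| ‖y‖ ∂μ

lemma mm_eq (μ : Measure E3) [IsProbabilityMeasure μ] (hμrad : IsRadial μ) (a : ℝ) (ha : 0 < a) :
    a * Vpot μ (a • e1) = mm μ a := by
  rw [Vpot, newton μ hμrad a ha, mm, abs_of_pos ha]
  simp only [div_eq_mul_inv]
  rw [integral_const_mul, integral_eq_lintegral_of_nonneg_ae]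
  · congr 2
    apply lintegral_congr
    intro y
    rw [ENNReal.ofReal_inv_of_pos (lt_max_of_lt_left ha)]
  · exact Eventually.of_forall fun y => inv_nonneg.2 (le_max_of_le_left ha.le)
  · apply Measurable.aestronglyMeasurable
    fun_prop

lemma frac_nonneg (a : ℝ) (y : E3) : 0 ≤ |a| / max |a| ‖y‖ :=
  div_nonneg (abs_nonneg _) (le_max_of_le_left (abs_nonneg _))

lemma frac_le (a : ℝ) (y : E3) : |a| / max |a| ‖y‖ ≤ 1 :=
  div_le_one_of_le₀ (le_max_left _ _) (le_max_of_le_left (abs_nonneg _))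

lemma mm_nonneg (μ : Measure E3) (a : ℝ) : 0 ≤ mm μ a :=
  integral_nonneg fun y => frac_nonneg a y

lemma mm_le (μ : Measure E3) [IsProbabilityMeasure μ] (a : ℝ) : mm μ a ≤ 1 := by
  have : mm μ a ≤ ∫ y, (1:ℝ) ∂μ := by
    apply integral_mono_of_nonneg
    · exact Eventually.of_forall fun y => frac_nonneg a y
    · exact integrable_const _
    · exact Eventually.of_forall fun y => frac_le a y
  simpa using this

lemma mm_zero (μ : Measure E3) : mm μ 0 = 0 := by simp [mm]

lemma mm_large (μ : Measure E3) [IsProbabilityMeasure μ] (R a : ℝ)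
    (hR : μ (closedBall (0:E3) R)ᶜ = 0) (ha : 0 < a) (haR : R ≤ a) : mm μ a = 1 := by
  have : mm μ a = ∫ y, (1:ℝ) ∂μ := by
    apply integral_congr_ae
    have h : ∀ᵐ y ∂μ, y ∈ closedBall (0:E3) R := hR
    filter_upwards [h] with y hy
    have : ‖y‖ ≤ R := by simpa using hy
    rw [abs_of_pos ha, max_eq_left (this.trans haR), div_self ha.ne']
  simpa using this

lemma no_atom (μ : Measure E3) (hD : DD μ μ < ⊤) : μ {0} = 0 := by
  by_contra h0
  have h1 : ∫⁻ y, coul 0 y ∂μ = ⊤ := by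
    apply eq_top_iff.2
    calc (⊤ : ℝ≥0∞) = coul 0 0 * μ {0} := by
          rw [coul]; simp [ENNReal.top_mul h0]
      _ = ∫⁻ y in {0}, coul 0 y ∂μ := by rw [lintegral_singleton]
      _ ≤ _ := setLIntegral_le_lintegral _ _
  have h2 : ∫⁻ x, ∫⁻ y, coul x y ∂μ ∂μ = ⊤ := by
    apply eq_top_iff.2
    calc (⊤ : ℝ≥0∞) = (∫⁻ y, coul 0 y ∂μ) * μ {0} := by
          rw [h1, ENNReal.top_mul h0]
      _ = ∫⁻ x in {0}, ∫⁻ y, coul x y ∂μ ∂μ := by rw [lintegral_singleton]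
      _ ≤ _ := setLIntegral_le_lintegral _ _
  rw [DD, h2] at hD
  simp at hD

lemma mm_cont (μ : Measure E3) [IsProbabilityMeasure μ] (hD : DD μ μ < ⊤) :
    Continuous (mm μ) := by
  apply continuous_of_dominated (bound := fun _ => 1)
  · intro a
    apply Measurable.aestronglyMeasurable
    fun_prop
  · intro a
    refine Eventually.of_forall fun y => ?_
    rw [Real.norm_of_nonneg (frac_nonneg a y)]
    exact frac_le a y
  · exact integrable_const _
  · have h : ∀ᵐ y ∂μ, y ≠ 0 := by
      simpa [ae_iff] using no_atom μ hD
    filter_upwards [h] with y hy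
    apply Continuous.div (by fun_prop) (by fun_prop)
    intro a
    exact (lt_max_of_lt_right (norm_pos_iff.2 hy)).ne'

lemma Psi_eq (μ : Measure E3) [IsProbabilityMeasure μ] (hμrad : IsRadial μ) (a b : ℝ)
    (ha : 0 < a) (hb : 0 < b) :
    Psi μ (Measure.dirac 0) a b =
        a ^ 3 * b ^ 3 * (2 - a * Vpot μ (a • e1) - b * Vpot μ (b • e1)) := by
  have dd : ∀ (v : E3) (c : ℝ), dilate (Measure.dirac 0) v c = Measure.dirac v := by
    intro v c
    rw [dilate, Measure.map_dirac' (f := fun u : E3 => v + c⁻¹ • u) (by fun_prop)]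
    simp
  have hscale : ∀ (c : ℝ) (u : E3), 0 < c →
      (ENNReal.ofReal ‖e1 - c⁻¹ • u‖)⁻¹ = ENNReal.ofReal c * coul (c • e1) u := by
    intro c u hc
    have : c • e1 - u = c • (e1 - c⁻¹ • u) := by
      rw [smul_sub, smul_smul, mul_inv_cancel₀ hc.ne', one_smul]
    have hc0 : ENNReal.ofReal c ≠ 0 := by simpa using hc
    rw [coul, this, norm_smul, Real.norm_of_nonneg hc.le, ENNReal.ofReal_mul hc.le,
      ENNReal.mul_inv (Or.inl hc0) (Or.inl ENNReal.ofReal_ne_top), ← mul_assoc,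
      ENNReal.mul_inv_cancel hc0 ENNReal.ofReal_ne_top, one_mul]
  have hDr : ∀ ν₁ ν₂ : Measure E3, 2 * Dr ν₁ ν₂ = (∫⁻ x, ∫⁻ y, coul x y ∂ν₂ ∂ν₁).toReal := by
    intro ν₁ ν₂
    rw [Dr, DD, ENNReal.toReal_mul]
    simp
  have hsymm : ∀ x y, coul x y = coul y x := by
    intro x y
    rw [coul, coul, norm_sub_rev]
  have h1 : 2 * Dr (dilate μ 0 a) (dilate (Measure.dirac 0) e1 b) = a * Vpot μ (a • e1) := by
    rw [hDr, dd]
    simp only [lintegral_dirac]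
    rw [dilate, lintegral_map (by unfold coul; fun_prop) (by fun_prop)]
    have : ∀ u : E3, coul (0 + a⁻¹ • u) e1 = ENNReal.ofReal a * coul (a • e1) u := by
      intro u
      rw [hsymm, ← hscale a u ha, coul, zero_add]
    simp only [this]
    rw [lintegral_const_mul _ (measurable_coul_right _), ENNReal.toReal_mul,
      ENNReal.toReal_ofReal ha.le, Vpot]
  have h2 : 2 * Dr (dilate (Measure.dirac 0) 0 a) (dilate μ e1 b) = b * Vpot μ (b • e1) := by
    rw [hDr, dd, lintegral_dirac, dilate,
      lintegral_map (measurable_coul_right _) (by fun_prop)]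
    have : ∀ u : E3, coul 0 (e1 + b⁻¹ • u)
        = ENNReal.ofReal b * coul (b • e1) (LinearIsometryEquiv.neg ℝ u) := by
      intro u
      rw [hsymm, ← hscale b _ hb, coul]
      simp
    simp only [this]
    rw [lintegral_const_mul _ (by unfold coul; fun_prop), ENNReal.toReal_mul,
      ENNReal.toReal_ofReal hb.le, Vpot]
    conv_rhs => rw [← hμrad (LinearIsometryEquiv.neg ℝ)]
    rw [lintegral_map (measurable_coul_right _) (LinearIsometryEquiv.continuous _).measurable]
  have h3 : 2 * Dr (dilate (Measure.dirac 0) 0 a) (dilate (Measure.dirac 0) e1 b) = 1 := by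
    rw [hDr, dd, dd, lintegral_dirac, lintegral_dirac]
    simp [coul, norm_e1]
  rw [Psi, Phi, Phi, Phi, if_pos ⟨ha, hb⟩, if_pos ⟨ha, hb⟩, if_pos ⟨ha, hb⟩, h1, h2, h3]
  ring

/-- **Link with the Lieb–Oxford proof** (Remark 2 of the paper): for a compactly supported
radial probability measure `μ` with `D(μ,μ) < ∞`, let `χ(a) = a³(1 - aV_μ(ae₁))` and let `ζ`
be the smallest non-decreasing function above `χ` on `[0,∞)`. Then `ζ` is bounded and
continuous with `ζ(a) ~ a³` as `a → 0`, and `f(a) = a³ζ(a)` belongs to `𝓕_{μδ₀}`, where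
`Ψ_{μδ₀}(a,b) = a³b³(2 - aV_μ(ae₁) - bV_μ(be₁))`. -/
theorem zeta_LO_link (μ : Measure E3) [IsProbabilityMeasure μ] (hμrad : IsRadial μ)
    (hsupp : ∃ R : ℝ, μ (closedBall (0:E3) R)ᶜ = 0) (hD : DD μ μ < ⊤)
    (ζ : ℝ → ℝ) (hmono : MonotoneOn ζ (Ici 0))
    (hmaj : ∀ a : ℝ, 0 ≤ a → a ^ 3 * (1 - a * Vpot μ (a • e1)) ≤ ζ a)
    (hmin : ∀ ζ' : ℝ → ℝ, MonotoneOn ζ' (Ici 0) →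
      (∀ a : ℝ, 0 ≤ a → a ^ 3 * (1 - a * Vpot μ (a • e1)) ≤ ζ' a) →
      ∀ a : ℝ, 0 ≤ a → ζ a ≤ ζ' a) :
    (∃ M : ℝ, ∀ a : ℝ, 0 ≤ a → |ζ a| ≤ M) ∧
    ContinuousOn ζ (Ici 0) ∧
    Tendsto (fun a => ζ a / a ^ 3) (𝓝[>] (0:ℝ)) (𝓝 1) ∧
    (fun a => a ^ 3 * ζ a) ∈ FF μ (Measure.dirac 0) ∧
    (∀ a b : ℝ, 0 < a → 0 < b →
      Psi μ (Measure.dirac 0) a b =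
        a ^ 3 * b ^ 3 * (2 - a * Vpot μ (a • e1) - b * Vpot μ (b • e1))) := by
 
  obtain ⟨R, hR⟩ := hsupp
  have hχ : ∀ a : ℝ, 0 ≤ a → a ^ 3 * (1 - a * Vpot μ (a • e1)) = a ^ 3 * (1 - mm μ a) := by
    intro a ha
    rcases ha.eq_or_lt with rfl | ha
    · simp
    · rw [mm_eq μ hμrad a ha]
  have hmaj' : ∀ a : ℝ, 0 ≤ a → a ^ 3 * (1 - mm μ a) ≤ ζ a := fun a ha => hχ a ha ▸ hmaj a ha
  have hmin' : ∀ ζ' : ℝ → ℝ, MonotoneOn ζ' (Ici 0) →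
      (∀ a : ℝ, 0 ≤ a → a ^ 3 * (1 - mm μ a) ≤ ζ' a) → ∀ a : ℝ, 0 ≤ a → ζ a ≤ ζ' a :=
    fun ζ' h1 h2 => hmin ζ' h1 fun a ha => (hχ a ha).symm ▸ h2 a ha
  have hmc := mm_cont μ hD
  have hcube : ∀ a : ℝ, 0 ≤ a → ζ a ≤ a ^ 3 := by
    apply hmin'
    · intro a ha b hb hab
      exact pow_le_pow_left₀ ha hab 3
    · intro a ha
      have := mm_nonneg μ a
      have h3 : 0 ≤ a ^ 3 := by positivity
      nlinarith
  have hnn : ∀ a : ℝ, 0 ≤ a → 0 ≤ ζ a := by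
    intro a ha
    refine le_trans ?_ (hmaj' a ha)
    exact mul_nonneg (by positivity) (by linarith [mm_le μ a])
  have hbd : ∀ a : ℝ, 0 ≤ a → ζ a ≤ (max R 1) ^ 3 := by
    apply hmin' (fun _ => (max R 1) ^ 3)
    · intro a ha b hb hab
      exact le_rfl
    · intro a ha
      have hM : (1:ℝ) ≤ max R 1 := le_max_right _ _
      rcases le_total a (max R 1) with h | h
      · have h1 : a ^ 3 ≤ (max R 1) ^ 3 := pow_le_pow_left₀ ha h 3
        have := mm_nonneg μ a
        have h3 : 0 ≤ a ^ 3 := by positivity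
        nlinarith
      · rw [mm_large μ R a hR (by linarith) ((le_max_left _ _).trans h)]
        simp only [sub_self, mul_zero]
        positivity
  -- the running maximum
  let X : ℝ → ℝ := fun a => a ^ 3 * (1 - mm μ a)
  have hXc : Continuous X := by
    show Continuous fun a : ℝ => a ^ 3 * (1 - mm μ a)
    fun_prop
  let Z : ℝ → ℝ := fun a => sSup ((fun t => X (t * a)) '' Icc (0:ℝ) 1)
  have hZc : Continuous Z := by
    apply IsCompact.continuous_sSup isCompact_Icc (f := fun a t => X (t * a))
    exact hXc.comp (by fun_prop)
  have hba : ∀ a, BddAbove ((fun t => X (t * a)) '' Icc (0:ℝ) 1) := fun a =>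
    (isCompact_Icc.image (hXc.comp (by fun_prop))).bddAbove
  have hne : ∀ a, ((fun t => X (t * a)) '' Icc (0:ℝ) 1).Nonempty := fun a =>
    (nonempty_Icc.2 zero_le_one).image _
  have hle : ∀ a t : ℝ, 0 ≤ t → t ≤ a → X t ≤ Z a := by
    intro a t ht hta
    apply le_csSup (hba a)
    rcases (ht.trans hta).eq_or_lt with h0 | h0
    · refine ⟨0, by simp, ?_⟩
      have : t = 0 := by linarith
      simp [this]
    · refine ⟨t / a, ⟨by positivity, (div_le_one h0).2 hta⟩, ?_⟩
      simp only
      rw [div_mul_cancel₀ _ h0.ne']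
  have hZmono : MonotoneOn Z (Ici 0) := by
    intro a ha b hb hab
    have ha : 0 ≤ a := ha
    apply csSup_le (hne a)
    rintro _ ⟨t, ht, rfl⟩
    apply hle
    · exact mul_nonneg ht.1 ha
    · nlinarith [ht.2]
  have hζZ : ∀ a : ℝ, 0 ≤ a → ζ a = Z a := by
    intro a ha
    apply le_antisymm
    · exact hmin' Z hZmono (fun a ha => hle a a ha le_rfl) a ha
    · apply csSup_le (hne a)
      rintro _ ⟨t, ht, rfl⟩
      have h0 : 0 ≤ t * a := mul_nonneg ht.1 ha
      exact (hmaj' _ h0).trans (hmono h0 ha (by nlinarith [ht.2]))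
  have hζc : ContinuousOn ζ (Ici 0) := hZc.continuousOn.congr fun a ha => hζZ a ha
  refine ⟨⟨(max R 1) ^ 3, fun a ha => ?_⟩, hζc, ?_, ⟨?_, ?_, ?_⟩, fun a b ha hb =>
    Psi_eq μ hμrad a b ha hb⟩
  · rw [abs_of_nonneg (hnn a ha)]
    exact hbd a ha
  · have h1 : Tendsto (fun a => 1 - mm μ a) (𝓝[>] (0:ℝ)) (𝓝 1) := by
      have : Tendsto (fun a => 1 - mm μ a) (𝓝 (0:ℝ)) (𝓝 (1 - mm μ 0)) :=
        (continuous_const.sub hmc).tendsto 0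
      rw [mm_zero, sub_zero] at this
      exact this.mono_left nhdsWithin_le_nhds
    refine tendsto_of_tendsto_of_tendsto_of_le_of_le' h1 tendsto_const_nhds ?_ ?_
    · filter_upwards [self_mem_nhdsWithin] with a ha
      have ha : 0 < a := ha
      rw [le_div_iff₀ (by positivity), mul_comm]
      exact hmaj' a ha.le
    · filter_upwards [self_mem_nhdsWithin] with a ha
      have ha : 0 < a := ha
      exact div_le_one_of_le₀ (hcube a ha.le) (by positivity)
  · exact (continuous_pow 3).continuousOn.mul hζc
  · intro a ha
    exact mul_nonneg (by positivity) (hnn a ha)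
  · intro a b ha hb
    by_cases h : 0 < a ∧ 0 < b
    · obtain ⟨ha', hb'⟩ := h
      rw [Psi_eq μ hμrad a b ha' hb']
      have e1 := hmaj a ha
      have e2 := hmaj b hb
      have ha3 : 0 ≤ a ^ 3 := by positivity
      have hb3 : 0 ≤ b ^ 3 := by positivity
      have k1 := mul_le_mul_of_nonneg_left e1 hb3
      have k2 := mul_le_mul_of_nonneg_left e2 ha3
      have k3 : 0 ≤ (b ^ 3 - a ^ 3) * (ζ b - ζ a) := by
        rcases le_total a b with h | h
        · exact mul_nonneg (sub_nonneg.2 (pow_le_pow_left₀ ha h 3)) (sub_nonneg.2 (hmono ha hb h))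
        · exact mul_nonneg_of_nonpos_of_nonpos (sub_nonpos.2 (pow_le_pow_left₀ hb h 3))
            (sub_nonpos.2 (hmono hb ha h))
      simp only
      linarith
    · have : Psi μ (Measure.dirac 0) a b = 0 := by simp [Psi, Phi, h]
      rw [this]
      exact add_nonneg (mul_nonneg (by positivity) (hnn a ha))
        (mul_nonneg (by positivity) (hnn b hb))
end
end
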